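/- arXiv:1307.8353 — 5 statements merged into one kernel-verified Lean document; each statement's English description precedes it below -/
import Mathlib

section
/- Let k, m be natural numbers with 1 ≤ m ≤ k, and let P₁,…,P_m ∈ ℝ[X₁,…,X_k] with total degrees d_i = deg P_i satisfying 1 ≤ d₁ ≤ d₂ ≤ … ≤ d_m. For each i let H_i ∈ ℝ[X₀,X₁,…,X_k] be the homogenization of P_i, i.e. the homogeneous polynomial of degree d_i with H_i(1,x₁,…,x_k) = P_i(x₁,…,x_k). Suppose that, viewed over ℂ, the H_i define a non-singular complete intersection in ℙ^k_ℂ, namely: (a) for each i and every nonzero z ∈ ℂ^{k+1} with H_i(z) = 0, the gradient (∂H_i/∂X₀(z),…,∂H_i/∂X_k(z)) is nonzero; and (b) for every nonzero z ∈ ℂ^{k+1} with H₁(z) = … = H_m(z) = 0, the m gradient vectors (∂H_i/∂X₀(z),…,∂H_i/∂X_k(z)), i = 1,…,m, are linearly independent over ℂ. If the real algebraic set Z = {x ∈ ℝ^k : P₁(x) = … = P_m(x) = 0} is bounded, then Z has finitely many connected components and their number is at most binom(k+1, m+1) · d₁⋯d_{m−1} · d_m^{k−m+1} + 2(k−m+1).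 -/
open MvPolynomial

/-- Exponent vectors on `α` of total degree at most `n`. -/
abbrev BoundedExponent (α : Type*) [Fintype α] (n : ℕ) : Type _ :=
  {q : α → ℕ // ∑ i, q i ≤ n}

namespace BoundedExponent

/-- Exponent vectors of degree at most `n` are multisets of size `n` on `Option α`. -/
noncomputable def equivSym (α : Type*) [Fintype α] (n : ℕ) :
    BoundedExponent α n ≃ Sym (Option α) n :=
  Equiv.trans
    { toFun := fun q => ⟨fun o => o.elim (n - ∑ i, q.1 i) q.1, by
        have := q.2
        simp only [Fintype.sum_option, Option.elim_none, Option.elim_some]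
        omega⟩
      invFun := fun r => ⟨fun i => r.1 (some i), by
        have h := r.2
        rw [Fintype.sum_option] at h
        exact (Nat.le_add_left _ _).trans_eq h⟩
      left_inv := fun q => rfl
      right_inv := fun r => by
        have := r.2
        rw [Fintype.sum_option] at this
        ext o
        cases o with
        | none => simp only [Option.elim_none]; omega
        | some i => rfl : BoundedExponent α n ≃ {r : Option α → ℕ // ∑ i, r i = n} }
    (open Classical in Sym.equivNatSumOfFintype (Option α) n).symm

instance (α : Type*) [Fintype α] (n : ℕ) : Finite (BoundedExponent α n) := by
  classical
  exact Finite.of_equiv _ (equivSym α n).symm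

theorem natCard (α : Type*) [Fintype α] (n : ℕ) :
    Nat.card (BoundedExponent α n) = (Fintype.card α + n).choose (Fintype.card α) := by
  rw [Nat.card_congr (equivSym α n), Sym.natCard_sym_eq_choose, Nat.card_eq_fintype_card,
    Fintype.card_option, Nat.choose_symm_of_eq_add (a := n) (b := Fintype.card α)]
  all_goals grind

end BoundedExponent

/-- Exponent vectors of degree at most `S` whose `e i`-th entry is less than `d i`. -/
abbrev ReducedExponent {σ ι : Type*} [Fintype σ] (e : ι → σ) (d : ι → ℕ) (S : ℕ) : Type _ :=
  {q : BoundedExponent σ S // ∀ i, q.1 (e i) < d i}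

theorem ReducedExponent.natCard_le {σ ι : Type*} [Fintype σ] [Fintype ι] {e : ι → σ}
    (he : Function.Injective e) (d : ι → ℕ) (S : ℕ) :
    Nat.card (ReducedExponent e d S) ≤
      (∏ i, d i) * (Fintype.card σ - Fintype.card ι + S).choose
        (Fintype.card σ - Fintype.card ι) := by
  classical
  let c : Type _ := {j : σ // j ∉ Set.range e}
  have hc : Fintype.card c = Fintype.card σ - Fintype.card ι := by
    rw [Fintype.card_subtype_compl]
    congr 1
    exact (Fintype.card_congr (Equiv.ofInjective e he)).symm
  let f : ReducedExponent e d S → (∀ i, Fin (d i)) × BoundedExponent c S := fun q =>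
    (fun i => ⟨q.1.1 (e i), q.2 i⟩, ⟨fun j => q.1.1 j, by
      refine le_trans ?_ q.1.2
      rw [← Fintype.sum_subtype_add_sum_subtype (fun j => j ∉ Set.range e)]
      exact Nat.le_add_right _ _⟩)
  have hf : Function.Injective f := by
    intro q r h
    simp only [f, Prod.mk.injEq, Subtype.mk.injEq, funext_iff, Fin.mk.injEq] at h
    ext j
    by_cases hj : j ∈ Set.range e
    · obtain ⟨i, rfl⟩ := hj
      exact h.1 i
    · exact h.2 ⟨j, hj⟩
  refine (Nat.card_le_card_of_injective f hf).trans_eq ?_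
  rw [Nat.card_prod, BoundedExponent.natCard, hc, Nat.card_pi]
  simp

/-- The growth comparison behind the bihomogeneous Bézout bound. -/
theorem exists_dimension_count_lt (a m p D c : ℕ) :
    ∃ T : ℕ, p * (a + (D * T + c)).choose a * (m + T).choose m <
      (a + m + T).choose (a + m) * ((a + m).choose m * p * D ^ a + 1) := by
  have hlim : ∀ u v : ℝ, Filter.Tendsto (fun T : ℕ => (u * T + v) / ((T : ℝ) + 1))
      Filter.atTop (nhds u) := by
    intro u v
    have h0 : Filter.Tendsto (fun T : ℕ => u + (v - u) * (1 / ((T : ℝ) + 1)))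
        Filter.atTop (nhds (u + (v - u) * 0)) :=
      (tendsto_one_div_add_atTop_nhds_zero_nat.const_mul _).const_add _
    simp only [mul_zero, add_zero] at h0
    refine h0.congr fun T => ?_
    have : (T : ℝ) + 1 ≠ 0 := by positivity
    field_simp
    ring
  have hprod := (((hlim D (a + c)).pow a).mul ((hlim 1 m).pow m)).const_mul
    (((a + m).choose m * p : ℕ) : ℝ)
  have hlt : (((a + m).choose m * p : ℕ) : ℝ) * ((D : ℝ) ^ a * 1 ^ m) <
      (((a + m).choose m * p * D ^ a + 1 : ℕ) : ℝ) := by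
    push_cast
    simp
  obtain ⟨T, hT⟩ := (hprod.eventually_lt_const hlt).exists
  refine ⟨T, ?_⟩
  have hpos : (0 : ℝ) < (T : ℝ) + 1 := by positivity
  rw [div_pow, div_pow, div_mul_div_comm, ← pow_add, ← mul_div_assoc,
    div_lt_iff₀ (by positivity)] at hT
  have h1 : ((a + (D * T + c)).choose a : ℝ) ≤ (D * T + (a + c)) ^ a / a.factorial := by
    refine (Nat.choose_le_pow_div a _).trans_eq ?_
    push_cast
    ring
  have h2 : ((m + T).choose m : ℝ) ≤ (1 * T + m) ^ m / m.factorial := by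
    refine (Nat.choose_le_pow_div m _).trans_eq ?_
    push_cast
    ring
  have h3 : ((T : ℝ) + 1) ^ (a + m) / (a + m).factorial ≤ (a + m + T).choose (a + m) := by
    refine le_trans (le_of_eq ?_) (Nat.pow_le_choose (a + m) (a + m + T))
    rw [show a + m + T + 1 - (a + m) = T + 1 by omega]
    push_cast
    ring
  have h4 : ((a + m).choose m : ℝ) = (a + m).factorial / (a.factorial * m.factorial) := by
    rw [Nat.cast_choose ℝ (Nat.le_add_left m a), Nat.add_sub_cancel]
    ring
  have hfac : (0 : ℝ) < (a + m).factorial := by positivity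
  have key : (p : ℝ) * (a + (D * T + c)).choose a * (m + T).choose m <
      (a + m + T).choose (a + m) * (((a + m).choose m * p * D ^ a + 1 : ℕ) : ℝ) := by
    calc (p : ℝ) * (a + (D * T + c)).choose a * (m + T).choose m
        ≤ p * ((D * T + (a + c)) ^ a / a.factorial) * ((1 * T + m) ^ m / m.factorial) := by
          gcongr
      _ = (((a + m).choose m * p : ℕ) : ℝ) *
            ((D * T + (a + c)) ^ a * (1 * T + m) ^ m) / (a + m).factorial := by
          push_cast
          rw [h4]
          field_simp
      _ < (((a + m).choose m * p * D ^ a + 1 : ℕ) : ℝ) * (T + 1) ^ (a + m) /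
            (a + m).factorial := by
          gcongr
      _ = (T + 1) ^ (a + m) / (a + m).factorial *
            (((a + m).choose m * p * D ^ a + 1 : ℕ) : ℝ) := by ring
      _ ≤ _ := by gcongr
  exact_mod_cast key

/-- The linear endomorphism replacing `X (e i) ^ d i` by `f i` in each monomial which it divides
(for one chosen `i`), and killing the monomials divisible by no such power. -/
noncomputable def replaceLeading {σ ι : Type*} (e : ι → σ) (d : ι → ℕ)
    (f : ι → MvPolynomial σ ℝ) : MvPolynomial σ ℝ →ₗ[ℝ] MvPolynomial σ ℝ :=
  open Classical in
  (basisMonomials σ ℝ).constr ℝ fun p =>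
    if h : ∃ i, d i ≤ p (e i) then
      monomial (p - Finsupp.single (e h.choose) (d h.choose)) 1 * f h.choose
    else 0

theorem replaceLeading_monomial {σ ι : Type*} (e : ι → σ) (d : ι → ℕ)
    (f : ι → MvPolynomial σ ℝ) (p : σ →₀ ℕ) :
    (∃ i q, p = q + Finsupp.single (e i) (d i) ∧
      replaceLeading e d f (monomial p 1) = monomial q 1 * f i) ∨
    ((∀ i, p (e i) < d i) ∧ replaceLeading e d f (monomial p 1) = 0) := by
  classical
  have hb : replaceLeading e d f (monomial p 1) = _ :=
    (congrArg _ (congrFun (coe_basisMonomials σ ℝ) p).symm).trans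
      ((basisMonomials σ ℝ).constr_basis ℝ _ p)
  by_cases h : ∃ i, d i ≤ p (e i)
  · refine .inl ⟨h.choose, p - Finsupp.single (e h.choose) (d h.choose), ?_, ?_⟩
    · rw [tsub_add_cancel_of_le]
      simpa using h.choose_spec
    · rw [hb, dif_pos h]
  · refine .inr ⟨by simpa using h, ?_⟩
    rw [hb, dif_neg h]

theorem replaceLeading_mem {σ ι : Type*} (e : ι → σ) (d : ι → ℕ)
    (f : ι → MvPolynomial σ ℝ) (hf : ∀ i, (f i).totalDegree ≤ d i) (S : ℕ)
    (w : MvPolynomial σ ℝ) (hw : w ∈ restrictTotalDegree σ ℝ S) :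
    replaceLeading e d f w ∈ restrictTotalDegree σ ℝ S := by
  rw [w.as_sum, map_sum]
  refine Submodule.sum_mem _ fun p hp => ?_
  have hpS : p.degree ≤ S :=
    (le_totalDegree hp).trans ((mem_restrictTotalDegree _ _ _).1 hw)
  rw [← mul_one (coeff p w), ← smul_eq_mul, ← smul_monomial, map_smul]
  refine Submodule.smul_mem _ _ ?_
  rcases replaceLeading_monomial e d f p with ⟨i, q, rfl, h⟩ | ⟨-, h⟩
  · rw [h, mem_restrictTotalDegree]
    refine (totalDegree_mul _ _).trans (le_trans ?_ hpS)
    rw [totalDegree_monomial _ one_ne_zero, map_add, Finsupp.degree_single]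
    exact Nat.add_le_add le_rfl (hf i)
  · rw [h]
    exact zero_mem _

/-- For all but finitely many `s`, every polynomial function of degree at most `S` on the zero set
of the `f i + s * X (e i) ^ d i` is a combination of reduced monomials. -/
theorem exists_finite_eval_mem_span {σ ι : Type*} [Fintype σ] (e : ι → σ) (d : ι → ℕ)
    (f : ι → MvPolynomial σ ℝ) (hf : ∀ i, (f i).totalDegree ≤ d i) (S : ℕ) :
    ∃ bad : Set ℝ, bad.Finite ∧ ∀ s ∉ bad, ∀ p : MvPolynomial σ ℝ, p.totalDegree ≤ S →
      (fun x : {x : σ → ℝ // ∀ i, eval x (f i) + s * x (e i) ^ d i = 0} => eval x.1 p) ∈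
        Submodule.span ℝ (Set.range fun (q : ReducedExponent e d S)
          (x : {x : σ → ℝ // ∀ i, eval x (f i) + s * x (e i) ^ d i = 0}) =>
            ∏ j, x.1 j ^ q.1.1 j) := by
  classical
  let V := restrictTotalDegree σ ℝ S
  have : Module.Finite ℝ V := by
    dsimp only [V]
    infer_instance
  let h : Module.End ℝ V := (replaceLeading e d f).restrict (replaceLeading_mem e d f hf S)
  refine ⟨spectrum ℝ (-h), Module.End.finite_spectrum _, fun s hs p hp => ?_⟩
  have hu : IsUnit (algebraMap ℝ (Module.End ℝ V) s - -h) := by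
    simpa [spectrum.mem_iff] using hs
  obtain ⟨⟨w, hw⟩, hwp⟩ := ((Module.End.isUnit_iff _).1 hu).2 ⟨p, (mem_restrictTotalDegree _ _ _).2 hp⟩
  have hwp' : s • w + replaceLeading e d f w = p := by
    have := congrArg Subtype.val hwp
    simpa [h, Module.algebraMap_end_apply] using this
  let X := {x : σ → ℝ // ∀ i, eval x (f i) + s * x (e i) ^ d i = 0}
  let R : MvPolynomial σ ℝ →ₗ[ℝ] (X → ℝ) :=
    LinearMap.pi fun x => (aeval x.1 : MvPolynomial σ ℝ →ₐ[ℝ] ℝ).toLinearMap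
  have hR : ∀ p x, R p x = eval x.1 p := fun p x => by simp [R, aeval_eq_eval]
  change (fun x : X => eval x.1 p) ∈ _
  have hRp : (fun x : X => eval x.1 p) = (R ∘ₗ (s • LinearMap.id + replaceLeading e d f)) w := by
    ext x
    simp only [LinearMap.comp_apply, LinearMap.add_apply, LinearMap.smul_apply, LinearMap.id_apply,
      hwp', hR]
  rw [hRp, w.as_sum, map_sum]
  refine Submodule.sum_mem _ fun r hr => ?_
  have hrS : r.degree ≤ S :=
    (le_totalDegree hr).trans ((mem_restrictTotalDegree _ _ _).1 hw)
  rw [← mul_one (coeff r w), ← smul_eq_mul, ← smul_monomial, map_smul]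
  refine Submodule.smul_mem _ _ ?_
  rcases replaceLeading_monomial e d f r with ⟨i, q, rfl, hr'⟩ | ⟨hlt, hr'⟩
  · convert Submodule.zero_mem _
    ext x
    have hx := x.2 i
    simp only [LinearMap.comp_apply, LinearMap.add_apply, LinearMap.smul_apply, LinearMap.id_apply,
      hr', hR, Pi.zero_apply]
    rw [monomial_add_single]
    simp only [map_add, smul_eval, map_mul, map_pow, eval_X]
    linear_combination (eval x.1 (monomial q 1)) * hx
  · simp only [LinearMap.comp_apply, LinearMap.add_apply, LinearMap.smul_apply, LinearMap.id_apply,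
      hr', add_zero, map_smul]
    refine Submodule.smul_mem _ _ (Submodule.subset_span
      ⟨⟨⟨r, by simpa [Finsupp.degree_eq_sum] using hrS⟩, hlt⟩, ?_⟩)
    ext x
    rw [hR, eval_monomial, one_mul, Finsupp.prod_fintype _ _ (by simp)]

/-- Functions on `ℝ^σ × ℝ^ι` which are polynomial, of degree at most `S` in the first variable
and of degree at most `T` in the second. -/
def bipolynomialFunctions (σ ι : Type*) [Fintype ι] (S T : ℕ) :
    Submodule ℝ ((σ → ℝ) × (ι → ℝ) → ℝ) :=
  Submodule.span ℝ {φ | ∃ (p : MvPolynomial σ ℝ) (q : BoundedExponent ι T), p.totalDegree ≤ S ∧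
    φ = fun v => eval v.1 p * ∏ i, v.2 i ^ q.1 i}

namespace bipolynomialFunctions

variable {σ ι : Type*} [Fintype ι] {S S' T T' : ℕ}

theorem mul_mem {φ ψ : (σ → ℝ) × (ι → ℝ) → ℝ} (hφ : φ ∈ bipolynomialFunctions σ ι S T)
    (hψ : ψ ∈ bipolynomialFunctions σ ι S' T') :
    φ * ψ ∈ bipolynomialFunctions σ ι (S + S') (T + T') := by
  have h := Submodule.mul_mem_mul hφ hψ
  rw [bipolynomialFunctions, bipolynomialFunctions, Submodule.span_mul_span] at h
  refine Submodule.span_mono ?_ h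
  rintro _ ⟨_, ⟨p, q, hp, rfl⟩, _, ⟨p', q', hp', rfl⟩, rfl⟩
  refine ⟨p * p', ⟨q.1 + q'.1, ?_⟩, (totalDegree_mul _ _).trans (Nat.add_le_add hp hp'), ?_⟩
  · simpa [Finset.sum_add_distrib] using Nat.add_le_add q.2 q'.2
  · ext v
    simp only [Pi.mul_apply, Pi.add_apply, map_mul, pow_add, Finset.prod_mul_distrib]
    ring

theorem mono (hS : S ≤ S') (hT : T ≤ T') :
    bipolynomialFunctions σ ι S T ≤ bipolynomialFunctions σ ι S' T' := by
  refine Submodule.span_mono ?_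
  rintro _ ⟨p, q, hp, rfl⟩
  exact ⟨p, ⟨q.1, q.2.trans hT⟩, hp.trans hS, rfl⟩

theorem eval_mem (p : MvPolynomial σ ℝ) (hp : p.totalDegree ≤ S) :
    (fun v => eval v.1 p) ∈ bipolynomialFunctions σ ι S T :=
  Submodule.subset_span ⟨p, ⟨0, by simp⟩, hp, by simp⟩

theorem snd_mem (i : ι) : (fun v => v.2 i) ∈ bipolynomialFunctions σ ι 0 1 := by
  classical
  refine Submodule.subset_span ⟨1, ⟨Pi.single i 1, by simp⟩, by simp, ?_⟩
  ext v
  rw [map_one, one_mul, Finset.prod_eq_single i] <;> simp +contextual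

theorem pow_mem {φ : (σ → ℝ) × (ι → ℝ) → ℝ} (hφ : φ ∈ bipolynomialFunctions σ ι S T) (n : ℕ) :
    φ ^ n ∈ bipolynomialFunctions σ ι (S * n) (T * n) := by
  induction n with
  | zero =>
    simpa using! eval_mem (σ := σ) (ι := ι) (S := 0) (T := 0) 1 (by simp)
  | succ n ih => simpa [pow_succ, mul_add] using! mul_mem ih hφ

theorem prod_pow_mem {τ : Type*} (s : Finset τ) {φ : τ → (σ → ℝ) × (ι → ℝ) → ℝ}
    (hφ : ∀ j, φ j ∈ bipolynomialFunctions σ ι S T) (β : τ → ℕ) :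
    ∏ j ∈ s, φ j ^ β j ∈
      bipolynomialFunctions σ ι (S * ∑ j ∈ s, β j) (T * ∑ j ∈ s, β j) := by
  classical
  induction s using Finset.induction_on with
  | empty => simpa using! eval_mem (σ := σ) (ι := ι) (S := 0) (T := 0) 1 (by simp)
  | insert j s hj ih =>
    rw [Finset.prod_insert hj, Finset.sum_insert hj, mul_add, mul_add]
    exact mul_mem (pow_mem (hφ j) _) ih

end bipolynomialFunctions

/-- A family of vectors in the span of fewer vectors is linearly dependent. -/
theorem exists_relation_of_mem_span {α β M : Type*} [Fintype α] [Finite β] [AddCommGroup M]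
    [Module ℝ M] (v : α → M) (w : β → M) (h : ∀ a, v a ∈ Submodule.span ℝ (Set.range w))
    (hcard : Nat.card β < Fintype.card α) : ∃ c : α → ℝ, c ≠ 0 ∧ ∑ a, c a • v a = 0 := by
  have := Fintype.ofFinite β
  have hli : ¬ LinearIndependent ℝ v := by
    intro hli
    have h1 := finrank_span_eq_card hli
    have h2 : Submodule.span ℝ (Set.range v) ≤ Submodule.span ℝ (Set.range w) :=
      Submodule.span_le.2 (by rintro _ ⟨a, rfl⟩; exact h a)
    have : Module.Finite ℝ (Submodule.span ℝ (Set.range w)) :=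
      Module.Finite.span_of_finite ℝ (Set.finite_range w)
    have h3 := Submodule.finrank_mono h2
    have h4 := finrank_range_le_card (R := ℝ) w
    rw [Nat.card_eq_fintype_card] at hcard
    simp only [Set.finrank] at h4
    omega
  obtain ⟨c, hc, a, ha⟩ := Fintype.not_linearIndependent_iff.1 hli
  exact ⟨c, fun h0 => ha (congrFun h0 a), hc⟩

/-- The bihomogeneous Bézout number of `|ι|` equations of bidegrees `(d i, 0)` and `|σ|` equations
of bidegree `(D, 1)` in `|σ| + |ι|` variables. -/
def bezoutNumber (σ : Type*) {ι : Type*} [Fintype σ] [Fintype ι] (d : ι → ℕ) (D : ℕ) : ℕ :=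
  (Fintype.card σ).choose (Fintype.card ι) * (∏ i, d i) * D ^ (Fintype.card σ - Fintype.card ι)

/-- For all but finitely many `s`, on the zero set of the `f i + s * X (e i) ^ d i` the functions
`g j` and `u` satisfy an algebraic relation whose degree in `u` is at most the Bézout number. -/
theorem exists_algebraic_relation {σ ι : Type*} [Fintype σ] [Fintype ι] {e : ι → σ}
    (he : Function.Injective e) (d : ι → ℕ) (f : ι → MvPolynomial σ ℝ)
    (hf : ∀ i, (f i).totalDegree ≤ d i) (D : ℕ) (g : σ → (σ → ℝ) × (ι → ℝ) → ℝ)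
    (hg : ∀ j, g j ∈ bipolynomialFunctions σ ι D 1) (u : (σ → ℝ) × (ι → ℝ) → ℝ)
    (hu : u ∈ bipolynomialFunctions σ ι 1 0) :
    ∃ (T : ℕ) (bad : Set ℝ), bad.Finite ∧ ∀ s ∉ bad,
      ∃ c : Fin (bezoutNumber σ d D + 1) → BoundedExponent σ T → ℝ, c ≠ 0 ∧
        ∀ v : (σ → ℝ) × (ι → ℝ), (∀ i, eval v.1 (f i) + s * v.1 (e i) ^ d i = 0) →
          ∑ j, (∑ᶠ β, c j β * ∏ i, g i v ^ β.1 i) * u v ^ (j : ℕ) = 0 := by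
  classical
  set B := bezoutNumber σ d D with hB
  have hcard : Fintype.card ι ≤ Fintype.card σ := Fintype.card_le_of_injective e he
  obtain ⟨T, hT⟩ := exists_dimension_count_lt (Fintype.card σ - Fintype.card ι) (Fintype.card ι)
    (∏ i, d i) D B
  rw [Nat.sub_add_cancel hcard] at hT
  change _ < _ * (B + 1) at hT
  obtain ⟨bad, hbad, hspan⟩ := exists_finite_eval_mem_span e d f hf (D * T + B)
  refine ⟨T, bad, hbad, fun s hs => ?_⟩
  let X := {v : (σ → ℝ) × (ι → ℝ) // ∀ i, eval v.1 (f i) + s * v.1 (e i) ^ d i = 0}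
  have : Fintype (BoundedExponent σ T) := Fintype.ofFinite _
  let w : ReducedExponent e d (D * T + B) × BoundedExponent ι T → X → ℝ := fun q x =>
    (∏ j, x.1.1 j ^ q.1.1.1 j) * ∏ i, x.1.2 i ^ q.2.1 i
  let φ : Fin (B + 1) × BoundedExponent σ T → X → ℝ := fun a x =>
    (∏ i, g i x.1 ^ a.2.1 i) * u x.1 ^ (a.1 : ℕ)
  let restr : ((σ → ℝ) × (ι → ℝ) → ℝ) →ₗ[ℝ] (X → ℝ) := LinearMap.funLeft ℝ ℝ Subtype.val
  have hrestr : ∀ ψ ∈ bipolynomialFunctions σ ι (D * T + B) T,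
      restr ψ ∈ Submodule.span ℝ (Set.range w) := by
    intro ψ hψ
    refine (Submodule.span_le (p := (Submodule.span ℝ (Set.range w)).comap restr)).2 ?_ hψ
    rintro _ ⟨p, q, hp, rfl⟩
    have h := hspan s hs p hp
    let mulq : ({x : σ → ℝ // ∀ i, eval x (f i) + s * x (e i) ^ d i = 0} → ℝ) →ₗ[ℝ] (X → ℝ) :=
      { toFun := fun θ x => θ ⟨x.1.1, x.2⟩ * ∏ i, x.1.2 i ^ q.1 i
        map_add' := fun a b => by ext x; simp [add_mul]
        map_smul' := fun a b => by ext x; simp [mul_assoc] }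
    have h' := Submodule.mem_map_of_mem (f := mulq) h
    rw [Submodule.map_span] at h'
    refine Submodule.span_mono ?_ h'
    rintro _ ⟨_, ⟨r, rfl⟩, rfl⟩
    exact ⟨(r, q), rfl⟩
  have hφ : ∀ a, φ a ∈ Submodule.span ℝ (Set.range w) := by
    intro a
    have h1 := bipolynomialFunctions.prod_pow_mem Finset.univ hg a.2.1
    have h2 := bipolynomialFunctions.pow_mem hu (a.1 : ℕ)
    have h3 := bipolynomialFunctions.mono (S' := D * T + B) (T' := T) ?_ ?_
      (bipolynomialFunctions.mul_mem h1 h2)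
    · convert hrestr _ h3
      ext x
      simp [φ, restr, LinearMap.funLeft_apply]
    · rw [one_mul]
      exact Nat.add_le_add (Nat.mul_le_mul_left _ a.2.2) (Nat.lt_succ_iff.1 a.1.2)
    · simpa using a.2.2
  obtain ⟨c, hc0, hc⟩ := exists_relation_of_mem_span φ w hφ (by
    rw [Nat.card_prod, BoundedExponent.natCard, Fintype.card_prod, Fintype.card_fin,
      ← Nat.card_eq_fintype_card (α := BoundedExponent σ T), BoundedExponent.natCard]
    refine (Nat.mul_le_mul_right _ (ReducedExponent.natCard_le he d _)).trans_lt ?_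
    rwa [mul_comm (B + 1)])
  refine ⟨fun j β => c (j, β), fun h => hc0 ?_, fun v hv => ?_⟩
  · ext ⟨j, β⟩
    exact congrFun (congrFun h j) β
  · have h := congrFun hc ⟨v, hv⟩
    rw [Finset.sum_apply, Fintype.sum_prod_type] at h
    rw [← Pi.zero_apply (M := fun _ : X => ℝ) ⟨v, hv⟩, ← h]
    refine Finset.sum_congr rfl fun j _ => ?_
    rw [finsum_eq_sum_of_fintype, Finset.sum_mul]
    refine Finset.sum_congr rfl fun β _ => ?_
    simp [φ, mul_assoc]

/-- Near a point where `F` vanishes with surjective derivative, all equations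
`F v + s • h v = w` with small `s` and `w` are solvable. -/
theorem eventually_exists_perturbed_solution {E G : Type*} [NormedAddCommGroup E]
    [NormedSpace ℝ E] [CompleteSpace E] [NormedAddCommGroup G] [NormedSpace ℝ G]
    [CompleteSpace G] {F h : E → G} {F' h' : E →L[ℝ] G} {v : E}
    (hF : HasStrictFDerivAt F F' v) (hsurj : F'.range = ⊤) (h0 : F v = 0)
    (hh : HasStrictFDerivAt h h' v) {U : Set E} (hU : U ∈ nhds v) :
    ∀ᶠ a : ℝ × G in nhds 0, ∃ v' ∈ U, F v' + a.1 • h v' = a.2 := by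
  let Ψ : ℝ × E → ℝ × G := fun a => (a.1, F a.2 + a.1 • h a.2)
  have hΨ0 : Ψ (0, v) = 0 := by simp [Ψ, h0]
  have hΨ := HasStrictFDerivAt.prodMk (hasStrictFDerivAt_fst (𝕜 := ℝ) (p := ((0 : ℝ), v)))
    ((HasStrictFDerivAt.comp (0, v) (g := F) hF hasStrictFDerivAt_snd).add
      ((hasStrictFDerivAt_fst (𝕜 := ℝ) (p := ((0 : ℝ), v))).smul
        (HasStrictFDerivAt.comp (0, v) (g := h) hh hasStrictFDerivAt_snd)))
  have hnhds := hΨ.map_nhds_eq_of_surj (by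
    rw [LinearMap.range_eq_top] at hsurj ⊢
    rintro ⟨s, w⟩
    obtain ⟨x, hx⟩ := hsurj (w - s • h v)
    refine ⟨(s, x), ?_⟩
    have hx' : F' x = w - s • h v := hx
    simp [hx'])
  change Filter.map Ψ (nhds (0, v)) = nhds (Ψ (0, v)) at hnhds
  rw [hΨ0] at hnhds
  have hmem : Ψ '' (Set.univ ×ˢ U) ∈ nhds (0 : ℝ × G) := by
    rw [← hnhds]
    exact Filter.image_mem_map (prod_mem_nhds Filter.univ_mem hU)
  filter_upwards [hmem]
  rintro _ ⟨⟨s, v'⟩, ⟨-, hv'⟩, rfl⟩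
  exact ⟨v', hv', rfl⟩

/-- Bihomogeneous Bézout bound for nondegenerate real solutions. -/
theorem card_le_bezoutNumber {σ ι : Type*} [Fintype σ] [Fintype ι] {e : ι → σ}
    (he : Function.Injective e) (d : ι → ℕ) (f : ι → MvPolynomial σ ℝ)
    (hf : ∀ i, (f i).totalDegree ≤ d i) (D : ℕ) (g : σ → (σ → ℝ) × (ι → ℝ) → ℝ)
    (hg : ∀ j, g j ∈ bipolynomialFunctions σ ι D 1) {N : ℕ} (v : Fin N → (σ → ℝ) × (ι → ℝ))
    (hv : Function.Injective fun n => (v n).1) (hfv : ∀ n i, eval (v n).1 (f i) = 0)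
    (hgv : ∀ n j, g j (v n) = 0)
    (hreg : ∀ n, ∃ F' : (σ → ℝ) × (ι → ℝ) →L[ℝ] (σ → ℝ) × (ι → ℝ), F'.range = ⊤ ∧
      HasStrictFDerivAt (fun v => ((fun j => g j v, fun i => eval v.1 (f i)) :
        (σ → ℝ) × (ι → ℝ))) F' (v n)) :
    N ≤ bezoutNumber σ d D := by
  classical
  by_contra! hN
  set B := bezoutNumber σ d D with hB
  obtain ⟨ℓ, hℓ⟩ := Module.exists_dual_forall_apply_ne_zero (K := ℝ) (M := σ → ℝ)
    (fun a : {a : Fin N × Fin N // a.1 ≠ a.2} => (v a.1.1).1 - (v a.1.2).1)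
    (fun a => sub_ne_zero.2 fun h => a.2 (hv h))
  have hℓinj : ∀ a b, a ≠ b → ℓ (v a).1 ≠ ℓ (v b).1 := fun a b hab h =>
    hℓ ⟨(a, b), hab⟩ (by simp [h])
  have hu : (fun v : (σ → ℝ) × (ι → ℝ) => ℓ v.1) ∈ bipolynomialFunctions σ ι 1 0 := by
    have h : (fun v : (σ → ℝ) × (ι → ℝ) => ℓ v.1) =
        fun v => eval v.1 (∑ j, C (ℓ fun i => if j = i then 1 else 0) * X j) := by
      ext v
      rw [LinearMap.pi_apply_eq_sum_univ ℓ v.1]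
      simp [mul_comm]
    rw [h]
    refine bipolynomialFunctions.eval_mem _ (totalDegree_finsetSum_le fun j _ => ?_)
    refine (totalDegree_mul _ _).trans ?_
    simp
  obtain ⟨T, bad, hbad, hrel⟩ := exists_algebraic_relation he d f hf D g hg _ hu
  obtain ⟨U, hU, hUd⟩ := (Set.finite_range fun n => ℓ (v n).1).t2_separation
  have hℓc : Continuous ℓ := LinearMap.continuous_of_finiteDimensional ℓ
  let h : (σ → ℝ) × (ι → ℝ) → (σ → ℝ) × (ι → ℝ) := fun v => (0, fun i => v.1 (e i) ^ d i)
  have hh : ∀ v, ∃ h', HasStrictFDerivAt h h' v := fun v => by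
    have : ContDiff ℝ 1 h := by fun_prop
    exact ⟨_, this.contDiffAt.hasStrictFDerivAt one_ne_zero⟩
  have hev : ∀ᶠ a : ℝ × ((σ → ℝ) × (ι → ℝ)) in nhds 0, ∀ n, ∃ v' : (σ → ℝ) × (ι → ℝ),
      ℓ v'.1 ∈ U (ℓ (v n).1) ∧ (∀ j, g j v' = a.2.1 j) ∧
        ∀ i, eval v'.1 (f i) + a.1 * v'.1 (e i) ^ d i = a.2.2 i := by
    refine Filter.eventually_all.2 fun n => ?_
    obtain ⟨F', hF', hF⟩ := hreg n
    obtain ⟨h', hh'⟩ := hh (v n)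
    have hUn : {v' : (σ → ℝ) × (ι → ℝ) | ℓ v'.1 ∈ U (ℓ (v n).1)} ∈ nhds (v n) :=
      (hℓc.comp continuous_fst).continuousAt.preimage_mem_nhds ((hU _).2.mem_nhds (hU _).1)
    filter_upwards [eventually_exists_perturbed_solution hF hF'
      (by ext <;> simp [hfv, hgv]) hh' hUn]
    rintro a ⟨v', hv', hav'⟩
    refine ⟨v', hv', fun j => ?_, fun i => ?_⟩
    · simpa [h] using congrFun (congrArg Prod.fst hav') j
    · simpa [h] using congrFun (congrArg Prod.snd hav') i
  rw [← Prod.mk_zero_zero, nhds_prod_eq] at hev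
  obtain ⟨pa, hpa, pb, hpb, hab⟩ := Filter.eventually_prod_iff.1 hev
  obtain ⟨s, hs, hsbad⟩ : ∃ s, pa s ∧ s ∉ bad := by
    obtain ⟨s, hs⟩ := ((infinite_of_mem_nhds 0 hpa).sdiff hbad).nonempty
    exact ⟨s, hs.1, hs.2⟩
  obtain ⟨c, hc0, hc⟩ := hrel s hsbad
  have : Fintype (BoundedExponent σ T) := Fintype.ofFinite _
  let Q : Fin (B + 1) → MvPolynomial σ ℝ := fun j =>
    ∑ β, monomial (Finsupp.equivFunOnFinite.symm β.1) (c j β)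
  have hQeval : ∀ j (v : (σ → ℝ) × (ι → ℝ)), eval (fun i => g i v) (Q j) =
      ∑ᶠ β, c j β * ∏ i, g i v ^ β.1 i := by
    intro j v
    rw [finsum_eq_sum_of_fintype, map_sum]
    refine Finset.sum_congr rfl fun β _ => ?_
    rw [eval_monomial, Finsupp.prod_fintype _ _ (by simp)]
    rfl
  rw [Prod.zero_eq_mk, nhds_prod_eq] at hpb
  have hpb' : ∀ᶠ z : σ → ℝ in nhds 0, pb (z, 0) := by
    have := (Filter.Eventually.curry hpb).mono fun z hz => hz.self_of_nhds
    exact this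
  obtain ⟨I, hI, hIsub⟩ : ∃ I : σ → Set ℝ, (∀ i, I i ∈ nhds 0) ∧
      Set.univ.pi I ⊆ {z | pb (z, 0)} := by
    obtain ⟨r, hr, hball⟩ := Metric.eventually_nhds_iff_ball.1 hpb'
    refine ⟨fun _ => Metric.ball 0 r, fun _ => Metric.ball_mem_nhds 0 hr, fun z hz => hball z ?_⟩
    rwa [ball_pi _ hr]
  have hQ : ∀ j, Q j = 0 := by
    intro j
    refine funext_set I (fun i => infinite_of_mem_nhds 0 (hI i)) fun z hz => ?_
    choose v' hv'U hv'g hv'f using hab hs (hIsub hz)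
    have hz' : ∀ n, (fun i => g i (v' n)) = z := fun n => funext (hv'g n)
    have hinj : Function.Injective fun n : Fin (B + 1) => ℓ (v' (Fin.castLE hN n)).1 := by
      intro a b hab
      by_contra hne
      have hne' := hℓinj (Fin.castLE hN a) (Fin.castLE hN b)
        fun h => hne (Fin.castLE_injective hN h)
      refine Set.disjoint_left.1 (hUd ⟨_, rfl⟩ ⟨_, rfl⟩ hne') (hv'U _) ?_
      have hab' : ℓ (v' (Fin.castLE hN a)).1 = ℓ (v' (Fin.castLE hN b)).1 := hab
      rw [hab']
      exact hv'U _
    have hvand := Matrix.eq_zero_of_forall_index_sum_mul_pow_eq_zero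
      (v := fun j => eval z (Q j)) hinj fun n => by
        have h := hc (v' (Fin.castLE hN n)) (by simpa using hv'f (Fin.castLE hN n))
        simpa only [← hQeval, hz'] using h
    simpa using congrFun hvand j
  refine hc0 (funext fun j => funext fun β => ?_)
  have hcoeff := congrArg (coeff (Finsupp.equivFunOnFinite.symm β.1)) (hQ j)
  simpa [Q, coeff_sum, coeff_monomial, Subtype.val_inj] using hcoeff

/-- Distinct components of a compact set have disjoint compact neighborhoods with no point of the
set on their boundary. -/
theorem exists_separated_neighborhoods {E : Type*} [MetricSpace E] [ProperSpace E] {Z Ω : Set E}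
    (hZ : IsCompact Z) (hΩ : IsOpen Ω) (hZΩ : Z ⊆ Ω) {N : ℕ} (K : Fin N → ConnectedComponents Z)
    (hK : Function.Injective K) :
    ∃ O A : Fin N → Set E, (∀ n, IsOpen (O n)) ∧ (∀ n, O n ⊆ A n) ∧ (∀ n, IsCompact (A n)) ∧
      (∀ n, A n ⊆ Ω) ∧ Pairwise (fun n n' => Disjoint (A n) (A n')) ∧
      (∀ n, (Z ∩ O n).Nonempty) ∧ ∀ n, Z ∩ A n ⊆ O n := by
  have : CompactSpace Z := isCompact_iff_compactSpace.1 hZ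
  obtain ⟨U, hU, hUd⟩ := (Set.finite_range K).t2_separation
  choose V hV hKV hVU using fun n => compact_exists_isClopen_in_isOpen (hU (K n)).2 (hU (K n)).1
  let π : Z → ConnectedComponents Z := ConnectedComponents.mk
  have hπ : Continuous π := ConnectedComponents.continuous_coe
  let L : Fin N → Set E := fun n => Subtype.val '' (π ⁻¹' V n)
  let M : Fin N → Set E := fun n => Subtype.val '' (π ⁻¹' (V n)ᶜ)
  have hLc : ∀ n, IsCompact (L n) := fun n =>
    ((hV n).isClosed.preimage hπ).isCompact.image continuous_subtype_val
  have hMc : ∀ n, IsCompact (M n) := fun n =>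
    ((hV n).compl.isClosed.preimage hπ).isCompact.image continuous_subtype_val
  have hLM : ∀ n, Disjoint (L n) (M n) := fun n =>
    (Set.disjoint_image_iff Subtype.val_injective).2 (disjoint_compl_right.preimage π)
  have hLΩ : ∀ n, L n ⊆ Ω := by
    rintro n _ ⟨z, -, rfl⟩
    exact hZΩ z.2
  choose δ₁ hδ₁ hd₁ using fun n => (hLM n).exists_cthickenings (hLc n) (hMc n).isClosed
  choose δ₂ hδ₂ hd₂ using fun n => (hLc n).exists_cthickening_subset_open hΩ (hLΩ n)
  obtain ⟨δ, hδ, hδ0⟩ : ∃ δ : ℝ, (∀ n, δ ≤ δ₁ n ∧ δ ≤ δ₂ n) ∧ 0 < δ := by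
    have h : ∀ᶠ δ : ℝ in nhdsWithin 0 (Set.Ioi 0), ∀ n, δ ≤ δ₁ n ∧ δ ≤ δ₂ n :=
      Filter.eventually_all.2 fun n => nhdsWithin_le_nhds
        ((eventually_le_nhds (hδ₁ n)).and (eventually_le_nhds (hδ₂ n)))
    exact (h.and self_mem_nhdsWithin).exists
  have hdisj : ∀ n, Disjoint (Metric.cthickening δ (L n)) (Metric.cthickening δ (M n)) := fun n =>
    (hd₁ n).mono (Metric.cthickening_mono (hδ n).1 _) (Metric.cthickening_mono (hδ n).1 _)
  refine ⟨fun n => Metric.thickening δ (L n), fun n => Metric.cthickening δ (L n),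
    fun n => Metric.isOpen_thickening, fun n => Metric.thickening_subset_cthickening _ _,
    fun n => (hLc n).cthickening, fun n => (Metric.cthickening_mono (hδ n).2 _).trans (hd₂ n),
    fun n n' hn => ?_, fun n => ?_, ?_⟩
  · refine (hdisj n).mono_right (Metric.cthickening_subset_of_subset _ ?_)
    refine Set.image_mono (Set.preimage_mono ?_)
    have h : Disjoint (U (K n)) (U (K n')) := hUd ⟨n, rfl⟩ ⟨n', rfl⟩ (hK.ne hn)
    exact (h.symm.mono (hVU n') (hVU n)).subset_compl_right
  · obtain ⟨z, hz⟩ := ConnectedComponents.surjective_coe (K n)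
    have hzV : z ∈ π ⁻¹' V n := by
      rw [Set.mem_preimage, show π z = K n from hz]
      exact hKV n
    exact ⟨z, z.2, Metric.self_subset_thickening hδ0 _ (Set.mem_image_of_mem Subtype.val hzV)⟩
  · rintro n z ⟨hz, hzA⟩
    by_cases h : π ⟨z, hz⟩ ∈ V n
    · exact Metric.self_subset_thickening hδ0 _
        (Set.mem_image_of_mem Subtype.val (show (⟨z, hz⟩ : Z) ∈ π ⁻¹' V n from h))
    · exact absurd (Metric.self_subset_cthickening _
          (Set.mem_image_of_mem Subtype.val (show (⟨z, hz⟩ : Z) ∈ π ⁻¹' (V n)ᶜ from h)))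
        (Set.disjoint_left.1 (hdisj n) hzA)

/-- Sard's theorem in equal dimensions: every nonempty open set contains a regular value. -/
theorem exists_regular_value {E : Type*} [NormedAddCommGroup E] [NormedSpace ℝ E]
    [FiniteDimensional ℝ E] {F : E → E} (hF : ContDiff ℝ 1 F) {A : Set E} (hA : IsOpen A)
    (hne : A.Nonempty) :
    ∃ w ∈ A, ∀ v, F v = w → (fderiv ℝ F v).range = ⊤ := by
  borelize E
  let μ : MeasureTheory.Measure E := MeasureTheory.Measure.addHaar
  have h0 := MeasureTheory.addHaar_image_eq_zero_of_det_fderivWithin_eq_zero μ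
    (s := {v | (fderiv ℝ F v).det = 0}) (f := F) (f' := fderiv ℝ F)
    (fun v _ => ((hF.differentiable one_ne_zero) v).hasFDerivAt.hasFDerivWithinAt) fun v hv => hv
  have hpos := hA.measure_pos μ hne
  obtain ⟨w, hwA, hw⟩ : ∃ w ∈ A, w ∉ F '' {v | (fderiv ℝ F v).det = 0} := by
    by_contra! h
    exact hpos.ne' (MeasureTheory.measure_mono_null h h0)
  refine ⟨w, hwA, fun v hv => ?_⟩
  have hdet : LinearMap.det (fderiv ℝ F v : E →ₗ[ℝ] E) ≠ 0 := fun h => hw ⟨v, h, hv⟩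
  exact LinearMap.range_eq_top.2 (LinearMap.equivOfDetNeZero _ hdet).surjective

/-- The derivative of a polynomial function. -/
noncomputable def evalDeriv {σ : Type*} [Fintype σ] (p : MvPolynomial σ ℝ) (x : σ → ℝ) :
    (σ → ℝ) →L[ℝ] ℝ :=
  ∑ j, eval x (pderiv j p) • ContinuousLinearMap.proj j

theorem evalDeriv_apply {σ : Type*} [Fintype σ] (p : MvPolynomial σ ℝ) (x y : σ → ℝ) :
    evalDeriv p x y = ∑ j, eval x (pderiv j p) * y j := by
  simp [evalDeriv]

theorem hasStrictFDerivAt_eval {σ : Type*} [Fintype σ] (p : MvPolynomial σ ℝ) (x : σ → ℝ) :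
    HasStrictFDerivAt (fun x => eval x p) (evalDeriv p x) x := by
  classical
  induction p using MvPolynomial.induction_on with
  | C a =>
    simp only [eval_C]
    convert hasStrictFDerivAt_const a x
    ext
    simp [evalDeriv_apply]
  | add p q hp hq =>
    have h : evalDeriv (p + q) x = evalDeriv p x + evalDeriv q x := by
      refine ContinuousLinearMap.ext fun y => ?_
      simp [evalDeriv_apply, add_mul, Finset.sum_add_distrib]
    simp only [map_add, h]
    exact hp.add hq
  | mul_X p i hp =>
    have h : evalDeriv (p * X i) x =
        eval x p • ContinuousLinearMap.proj i + x i • evalDeriv p x := by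
      refine ContinuousLinearMap.ext fun y => ?_
      simp only [evalDeriv_apply, Derivation.leibniz, pderiv_X, smul_eq_mul, map_add, map_mul,
        eval_X, add_apply, smul_apply,
        ContinuousLinearMap.proj_apply, add_mul, Finset.sum_add_distrib, Finset.mul_sum]
      congr 1
      · rw [Finset.sum_eq_single i] <;> simp +contextual [eq_comm]
      · exact Finset.sum_congr rfl fun j _ => by ring
    simp only [map_mul, eval_X, h]
    exact hp.mul (hasStrictFDerivAt_apply i x)

theorem contDiff_eval {σ : Type*} [Fintype σ] (p : MvPolynomial σ ℝ) {n : WithTop ℕ∞} :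
    ContDiff ℝ n fun x => eval x p :=
  (AnalyticOnNhd.eval_mvPolynomial p).contDiff

theorem continuous_gradient {σ : Type*} [Fintype σ] (p : MvPolynomial σ ℝ) :
    Continuous fun (x : σ → ℝ) (j : σ) => eval x (pderiv j p) :=
  continuous_pi fun j => MvPolynomial.continuous_eval (pderiv j p)

theorem range_pi_evalDeriv {σ ι : Type*} [Fintype σ] [Fintype ι] (P : ι → MvPolynomial σ ℝ)
    (x : σ → ℝ) (h : LinearIndependent ℝ fun i j => eval x (pderiv j (P i))) :
    (ContinuousLinearMap.pi fun i => evalDeriv (P i) x).range = ⊤ := by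
  classical
  let J : Matrix ι σ ℝ := Matrix.of fun i j => eval x (pderiv j (P i))
  have hrank : J.rank = Fintype.card ι := LinearIndependent.rank_matrix h
  have htop : LinearMap.range J.mulVecLin = ⊤ := by
    apply Submodule.eq_top_of_finrank_eq
    rw [Module.finrank_fintype_fun_eq_card]
    exact hrank
  rw [LinearMap.range_eq_top] at htop ⊢
  intro y
  obtain ⟨z, hz⟩ := htop y
  refine ⟨z, ?_⟩
  rw [← hz]
  ext i
  simp [J, evalDeriv_apply, Matrix.mulVec, dotProduct]

theorem totalDegree_pderiv_le {σ R : Type*} [CommSemiring R] (j : σ) (p : MvPolynomial σ R) :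
    (pderiv j p).totalDegree ≤ p.totalDegree := by
  classical
  conv_lhs => rw [p.as_sum, map_sum]
  refine totalDegree_finsetSum_le fun s hs => ?_
  rw [pderiv_monomial]
  refine (totalDegree_monomial_le _ _).trans (le_trans ?_ (le_totalDegree hs))
  exact Finsupp.degree_mono tsub_le_self

theorem isOpen_linearIndependent_gradients {σ ι : Type*} [Fintype σ] [Finite ι]
    (P : ι → MvPolynomial σ ℝ) :
    IsOpen {x : σ → ℝ | LinearIndependent ℝ fun i j => eval x (pderiv j (P i))} :=
  isOpen_setOfPred_linearIndependent.preimage (continuous_pi fun i => continuous_gradient (P i))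

/-- Every level set near zero has a critical point of every linear form in a neighborhood which
meets the zero set and is compatible with it at its boundary. -/
theorem eventually_exists_critical {σ ι : Type*} [Fintype σ] [Fintype ι]
    (P : ι → MvPolynomial σ ℝ) {O A : Set (σ → ℝ)} (hO : IsOpen O) (hOA : O ⊆ A)
    (hA : IsCompact A)
    (hAP : ∀ x ∈ A, LinearIndependent ℝ fun i j => eval x (pderiv j (P i)))
    (hne : ∃ x ∈ O, ∀ i, eval x (P i) = 0)
    (hAO : ∀ x ∈ A, (∀ i, eval x (P i) = 0) → x ∈ O) :
    ∀ᶠ y : ι → ℝ in nhds 0, ∀ c : σ → ℝ, ∃ x ∈ O, (∀ i, eval x (P i) = y i) ∧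
      ∃ l : ι → ℝ, ∀ j, ∑ i, l i * eval x (pderiv j (P i)) = c j := by
  classical
  let Φ : (σ → ℝ) → ι → ℝ := fun x i => eval x (P i)
  have hΦ : Continuous Φ := continuous_pi fun i => MvPolynomial.continuous_eval (P i)
  have h1 : ∀ᶠ y in nhds (0 : ι → ℝ), y ∈ Φ '' O := by
    obtain ⟨x, hxO, hx⟩ := hne
    have hd : HasStrictFDerivAt Φ (ContinuousLinearMap.pi fun i => evalDeriv (P i) x) x :=
      hasStrictFDerivAt_pi.2 fun i => hasStrictFDerivAt_eval (P i) x
    have := hd.map_nhds_eq_of_surj (range_pi_evalDeriv P x (hAP x (hOA hxO)))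
    rw [show Φ x = 0 from funext hx] at this
    rw [← this]
    exact Filter.image_mem_map (hO.mem_nhds hxO)
  have h2 : ∀ᶠ y in nhds (0 : ι → ℝ), y ∉ Φ '' (A \ O) := by
    refine ((hA.diff hO).image hΦ).isClosed.isOpen_compl.mem_nhds ?_
    rintro ⟨x, hx, hx0⟩
    exact hx.2 (hAO x hx.1 (congrFun hx0))
  filter_upwards [h1, h2] with y hy1 hy2 c
  obtain ⟨x₁, hx₁O, hx₁⟩ := hy1
  have hcomp : IsCompact (A ∩ Φ ⁻¹' {y}) := hA.inter_right (isClosed_singleton.preimage hΦ)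
  let φ : (σ → ℝ) →L[ℝ] ℝ := ∑ j, c j • ContinuousLinearMap.proj j
  obtain ⟨x, ⟨hxA, hxy⟩, hmin⟩ := hcomp.exists_isMinOn ⟨x₁, hOA hx₁O, hx₁⟩
    φ.continuous.continuousOn
  have hxy : Φ x = y := hxy
  have hxO : x ∈ O := by
    by_contra h
    exact hy2 ⟨x, ⟨hxA, h⟩, hxy⟩
  refine ⟨x, hxO, congrFun hxy, ?_⟩
  have hextr : IsLocalExtrOn φ {z | ∀ i, eval z (P i) = eval x (P i)} x := by
    refine Or.inl ?_
    filter_upwards [self_mem_nhdsWithin, nhdsWithin_le_nhds (hO.mem_nhds hxO)] with z hz hzO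
    exact hmin ⟨hOA hzO, (funext hz : Φ z = Φ x).trans hxy⟩
  obtain ⟨l, l₀, hl, hsum⟩ := hextr.exists_multipliers_of_hasStrictFDerivAt
    (fun i => hasStrictFDerivAt_eval (P i) x) φ.hasStrictFDerivAt
  have hsum' : ∀ j, ∑ i, l i * eval x (pderiv j (P i)) + l₀ * c j = 0 := fun j => by
    have := DFunLike.congr_fun hsum (Pi.single j 1)
    simpa [evalDeriv_apply, φ, Pi.single_apply] using this
  have hl₀ : l₀ ≠ 0 := by
    rintro rfl
    refine hl (Prod.ext (funext ?_) rfl)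
    refine Fintype.linearIndependent_iff.1 (hAP x hxA) l (funext fun j => ?_)
    simpa using hsum' j
  refine ⟨fun i => -(l i / l₀), fun j => ?_⟩
  have := hsum' j
  have h : ∑ i, -(l i / l₀) * eval x (pderiv j (P i)) =
      -(∑ i, l i * eval x (pderiv j (P i))) / l₀ := by
    rw [neg_div, Finset.sum_div, ← Finset.sum_neg_distrib]
    exact Finset.sum_congr rfl fun i _ => by ring
  rw [h, div_eq_iff hl₀]
  linarith

/-- Connected components of a bounded nonsingular real complete intersection are bounded in number
by a Bézout number. -/
theorem card_components_le_bezoutNumber {σ ι : Type*} [Fintype σ] [Fintype ι]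
    {e : ι → σ} (he : Function.Injective e) (P : ι → MvPolynomial σ ℝ) (d : ι → ℕ)
    (hd : ∀ i, (P i).totalDegree ≤ d i) (D : ℕ) (hD : ∀ i, d i ≤ D) {Z : Set (σ → ℝ)}
    (hZ : Z = {x | ∀ i, eval x (P i) = 0}) (hbdd : Bornology.IsBounded Z)
    (hreg : ∀ x ∈ Z, LinearIndependent ℝ fun i j => eval x (pderiv j (P i)))
    {N : ℕ} (K : Fin N → ConnectedComponents Z) (hK : Function.Injective K) :
    N ≤ bezoutNumber σ d D := by
  classical
  have hZc : IsCompact Z := by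
    refine Metric.isCompact_of_isClosed_isBounded ?_ hbdd
    rw [hZ, Set.ofPred_forall]
    exact isClosed_iInter fun i =>
      isClosed_singleton.preimage (MvPolynomial.continuous_eval (P i))
  obtain ⟨O, A, hO, hOA, hA, hAΩ, hdisj, hne, hAO⟩ := exists_separated_neighborhoods hZc
    (isOpen_linearIndependent_gradients P) hreg K hK
  have hev : ∀ᶠ y : ι → ℝ in nhds 0, ∀ n, ∀ c : σ → ℝ, ∃ x ∈ O n,
      (∀ i, eval x (P i) = y i) ∧
        ∃ l : ι → ℝ, ∀ j, ∑ i, l i * eval x (pderiv j (P i)) = c j := by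
    refine Filter.eventually_all.2 fun n => eventually_exists_critical P (hO n) (hOA n) (hA n)
      (hAΩ n) ?_ fun x hxA hx => hAO n ⟨?_, hxA⟩
    · obtain ⟨x, hxZ, hxO⟩ := hne n
      rw [hZ] at hxZ
      exact ⟨x, hxO, hxZ⟩
    · rw [hZ]
      exact hx
  obtain ⟨Y, hY, hYo, hY0⟩ := eventually_nhds_iff.1 hev
  let F : (σ → ℝ) × (ι → ℝ) → (σ → ℝ) × (ι → ℝ) := fun v =>
    (fun j => ∑ i, v.2 i * eval v.1 (pderiv j (P i)), fun i => eval v.1 (P i))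
  have hF : ContDiff ℝ 1 F := by
    refine ContDiff.prodMk (contDiff_pi.2 fun j => ContDiff.sum fun i _ => ContDiff.mul ?_ ?_)
      (contDiff_pi.2 fun i => (contDiff_eval (P i)).comp contDiff_fst)
    · exact (contDiff_apply ℝ ℝ i).comp contDiff_snd
    · exact (contDiff_eval (pderiv j (P i))).comp contDiff_fst
  obtain ⟨⟨c, y⟩, ⟨-, hy⟩, hreg⟩ := exists_regular_value hF
    (isOpen_univ.prod hYo) ⟨(0, 0), Set.mem_univ _, hY0⟩
  choose x hxO hxP l hl using fun n => hY y hy n c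
  have hxinj : Function.Injective x := by
    intro n n' h
    by_contra hn
    exact Set.disjoint_left.1 (hdisj hn) (hOA n (hxO n)) (h ▸ hOA n' (hxO n'))
  refine card_le_bezoutNumber he d (fun i => P i - C (y i)) (fun i => ?_) D
    (fun j v => ∑ i, v.2 i * eval v.1 (pderiv j (P i)) - c j) (fun j => ?_)
    (fun n => (x n, l n)) hxinj (fun n i => ?_) (fun n j => ?_) fun n => ?_
  · refine (totalDegree_sub _ _).trans ?_
    simpa using hd i
  · refine Submodule.sub_mem _ ?_ ?_
    · have : (fun v : (σ → ℝ) × (ι → ℝ) => ∑ i, v.2 i * eval v.1 (pderiv j (P i))) =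
          ∑ i, (fun v => eval v.1 (pderiv j (P i))) * (fun v => v.2 i) := by
        ext v
        simp [mul_comm]
      rw [this]
      refine Submodule.sum_mem _ fun i _ => ?_
      simpa using bipolynomialFunctions.mul_mem (S := D) (T := 0)
        (bipolynomialFunctions.eval_mem (pderiv j (P i))
          ((totalDegree_pderiv_le j (P i)).trans ((hd i).trans (hD i))))
        (bipolynomialFunctions.snd_mem i)
    · simpa using bipolynomialFunctions.eval_mem (σ := σ) (ι := ι) (S := D) (T := 1) (C (c j))
        (by simp)
  · simp [hxP n i]
  · simp [hl n j]
  · refine ⟨fderiv ℝ F (x n, l n), hreg _ ?_, ?_⟩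
    · exact Prod.ext (funext (hl n)) (funext (hxP n))
    · have h := (hF.contDiffAt.hasStrictFDerivAt one_ne_zero).sub_const (c, y) (x := (x n, l n))
      simp only [map_sub, eval_C]
      exact h

theorem eval_pderiv_succ_of_dehomogenization {k : ℕ} {H : MvPolynomial (Fin (k + 1)) ℝ}
    {P : MvPolynomial (Fin k) ℝ}
    (h : ∀ x : Fin k → ℝ, eval (Fin.cons 1 x) H = eval x P) (x : Fin k → ℝ) (j : Fin k) :
    eval (Fin.cons 1 x) (pderiv j.succ H) = eval x (pderiv j P) := by
  let L : (Fin k → ℝ) →L[ℝ] (Fin (k + 1) → ℝ) :=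
    ContinuousLinearMap.pi (Fin.cases 0 fun j => ContinuousLinearMap.proj j)
  have hL : ∀ y, L y + Pi.single 0 1 = Fin.cons 1 y := fun y => by
    ext i
    refine Fin.cases ?_ (fun i => ?_) i <;> simp [L]
  have h1 : HasStrictFDerivAt (fun y => L y + Pi.single 0 1) L x :=
    L.hasStrictFDerivAt.add_const _
  have h2 := (hasStrictFDerivAt_eval H (L x + Pi.single 0 1)).comp x h1
  simp only [hL, h] at h2
  have h4 := DFunLike.congr_fun
    (h2.hasFDerivAt.unique (hasStrictFDerivAt_eval P x).hasFDerivAt) (Pi.single j 1)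
  simpa [evalDeriv_apply, L, Fin.sum_univ_succ, Pi.single_apply] using h4

/-- Transversality of the homogenizations over `ℂ` implies that the real gradients are linearly
independent. -/
theorem linearIndependent_gradients_of_homogenization {k : ℕ} {ι : Type*} [Fintype ι]
    {P : ι → MvPolynomial (Fin k) ℝ} {d : ι → ℕ} {H : ι → MvPolynomial (Fin (k + 1)) ℝ}
    (hhom : ∀ i, (H i).IsHomogeneous (d i))
    (hdehom : ∀ i (x : Fin k → ℝ), eval (Fin.cons 1 x) (H i) = eval x (P i))
    (htransverse : ∀ z : Fin (k + 1) → ℂ, z ≠ 0 →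
      (∀ i, eval z (map (algebraMap ℝ ℂ) (H i)) = 0) →
      LinearIndependent ℂ fun i j => eval z (pderiv j (map (algebraMap ℝ ℂ) (H i))))
    {x : Fin k → ℝ} (hx : ∀ i, eval x (P i) = 0) :
    LinearIndependent ℝ fun i j => eval x (pderiv j (P i)) := by
  let w : Fin (k + 1) → ℝ := Fin.cons 1 x
  have hmap : ∀ q : MvPolynomial (Fin (k + 1)) ℝ,
      eval (fun i => (w i : ℂ)) (map (algebraMap ℝ ℂ) q) = (eval w q : ℝ) := fun q => by
    rw [eval_map]
    exact (eval₂_comp_left (algebraMap ℝ ℂ) (RingHom.id ℝ) w q).symm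
  have hHw : ∀ i, eval w (H i) = 0 := fun i => (hdehom i x).trans (hx i)
  have hind := htransverse (fun i => (w i : ℂ)) (fun h => by simpa [w] using congrFun h 0)
    fun i => by rw [hmap, hHw, Complex.ofReal_zero]
  simp only [pderiv_map, hmap] at hind
  rw [Fintype.linearIndependent_iff] at hind ⊢
  intro l hl i
  have hsucc : ∀ j : Fin k, ∑ i, l i * eval w (pderiv j.succ (H i)) = 0 := fun j => by
    simp only [w, eval_pderiv_succ_of_dehomogenization (hdehom _)]
    simpa using congrFun hl j
  have heuler : ∀ i, eval w (pderiv 0 (H i)) =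
      -∑ j : Fin k, x j * eval w (pderiv j.succ (H i)) := fun i => by
    have h := congrArg (eval w) (hhom i).sum_X_mul_pderiv
    rw [map_nsmul, hHw, smul_zero, map_sum, Fin.sum_univ_succ] at h
    simp only [map_mul, eval_X, w, Fin.cons_zero, Fin.cons_succ, one_mul] at h ⊢
    linarith
  have hzero : ∑ i, l i * eval w (pderiv 0 (H i)) = 0 := by
    simp only [heuler, mul_neg, Finset.sum_neg_distrib, Finset.mul_sum, neg_eq_zero]
    rw [Finset.sum_comm]
    refine Finset.sum_eq_zero fun j _ => ?_
    rw [← mul_zero (x j), ← hsucc j, Finset.mul_sum]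
    exact Finset.sum_congr rfl fun i _ => by ring
  have hall : ∀ j, ∑ i, l i * eval w (pderiv j (H i)) = 0 := Fin.cases hzero hsucc
  have := hind (fun i => (l i : ℂ)) (funext fun j => by
    simpa using congrArg (fun r : ℝ => (r : ℂ)) (hall j)) i
  exact_mod_cast this

/-- if the homogenizations of `P₁,…,P_m` define a non-singular
complete intersection in complex projective `k`-space and the common real zero
set `Z` is bounded, then the number of connected components of `Z` is at most
`binom(k+1,m+1)·d₁⋯d_{m−1}·d_m^{k−m+1} + 2(k−m+1)`. -/
theorem stmt2 (k m : ℕ) (hm : 1 ≤ m) (hmk : m ≤ k)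
    (P : Fin m → MvPolynomial (Fin k) ℝ) (d : Fin m → ℕ)
    (hdeg : ∀ i, (P i).totalDegree = d i)
    (hd1 : ∀ i, 1 ≤ d i)
    (hmono : Monotone d)
    (H : Fin m → MvPolynomial (Fin (k + 1)) ℝ)
    (hhom : ∀ i, (H i).IsHomogeneous (d i))
    (hdehom : ∀ i (x : Fin k → ℝ),
      MvPolynomial.eval (Fin.cons 1 x) (H i) = MvPolynomial.eval x (P i))
    (hsmooth : ∀ i (z : Fin (k + 1) → ℂ), z ≠ 0 →
      MvPolynomial.eval z (MvPolynomial.map (algebraMap ℝ ℂ) (H i)) = 0 →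
      (fun j : Fin (k + 1) =>
        MvPolynomial.eval z (MvPolynomial.pderiv j
          (MvPolynomial.map (algebraMap ℝ ℂ) (H i)))) ≠ 0)
    (htransverse : ∀ z : Fin (k + 1) → ℂ, z ≠ 0 →
      (∀ i, MvPolynomial.eval z (MvPolynomial.map (algebraMap ℝ ℂ) (H i)) = 0) →
      LinearIndependent ℂ (fun i : Fin m => fun j : Fin (k + 1) =>
        MvPolynomial.eval z (MvPolynomial.pderiv j
          (MvPolynomial.map (algebraMap ℝ ℂ) (H i)))))
    (Z : Set (Fin k → ℝ))
    (hZ : Z = {x | ∀ i, MvPolynomial.eval x (P i) = 0})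
    (hbdd : Bornology.IsBounded Z) :
    Finite (ConnectedComponents ↥Z) ∧
    Nat.card (ConnectedComponents ↥Z) ≤
      Nat.choose (k + 1) (m + 1) * (∏ i, d i) * (d ⟨m - 1, by omega⟩) ^ (k - m)
        + 2 * (k - m + 1) := by
  have hreg : ∀ x ∈ Z, LinearIndependent ℝ fun i j => eval x (pderiv j (P i)) := fun x hx =>
    linearIndependent_gradients_of_homogenization hhom hdehom htransverse (by rwa [hZ] at hx)
  have hbound : ∀ {N : ℕ} (K : Fin N → ConnectedComponents Z), Function.Injective K →
      N ≤ bezoutNumber (Fin k) d (d ⟨m - 1, by omega⟩) := fun K hK =>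
    card_components_le_bezoutNumber (Fin.castLE_injective hmk) P d (fun i => (hdeg i).le) _
      (fun i => hmono (Fin.mk_le_mk.2 (by omega) : i ≤ ⟨m - 1, by omega⟩)) hZ hbdd hreg K hK
  have hfin : Finite (ConnectedComponents Z) := by
    by_contra h
    rw [not_finite_iff_infinite] at h
    let f := (Fin.valEmbedding (n := bezoutNumber (Fin k) d (d ⟨m - 1, by omega⟩) + 1)).trans
      (Infinite.natEmbedding (ConnectedComponents Z))
    exact absurd (hbound f f.injective) (by omega)
  refine ⟨hfin, (hbound _ (Finite.equivFin (ConnectedComponents Z)).symm.injective).trans ?_⟩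
  rw [bezoutNumber, Fintype.card_fin, Fintype.card_fin]
  refine le_add_right (Nat.mul_le_mul_right _ (Nat.mul_le_mul_right _ ?_))
  rw [Nat.choose_succ_succ]
  exact Nat.le_add_right _ _
end

section
/- Let k ≥ 1 and let F, P, Q ∈ ℝ[X₁,…,X_k] be polynomials with F·Q = P and Q ≠ 0, let R > 0 be a real number, and set N = 2·deg(Q) + 1 (total degree). Define T = {(x,t) ∈ ℝ^k × ℝ : t > 0 and P(x)² ≤ t·(Q(x)² − t^N) and |x|² ≤ R²}, where |x|² = x₁² + … + x_k². Then T_limit = {x ∈ ℝ^k : F(x) = 0 and |x|² ≤ R²}, i.e. the Hausdorff limit of the family (T_t) as t → 0⁺ is exactly the zero set of F intersected with the closed ball of radius R. -/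
open MvPolynomial

/-- A nonzero polynomial is nonzero somewhere in every ball around the origin. -/
theorem exists_eval_ne_zero_sum_sq_le {k : ℕ} (hk : 1 ≤ k) {Q : MvPolynomial (Fin k) ℝ}
    (hQ : Q ≠ 0) {R : ℝ} (hR : 0 < R) :
    ∃ y : Fin k → ℝ, eval y Q ≠ 0 ∧ ∑ i, y i ^ 2 ≤ R ^ 2 := by
  have hk' : (1 : ℝ) ≤ k := by exact_mod_cast hk
  have hRk : 0 < R / k := by positivity
  by_contra! h
  refine hQ (MvPolynomial.funext_set (fun _ => Set.Icc 0 (R / k))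
    (fun _ => Set.Icc_infinite hRk) fun y hy => ?_)
  by_contra hy0
  refine (h y (by simpa using hy0)).not_ge ?_
  calc ∑ i, y i ^ 2 ≤ ∑ _i : Fin k, (R / k) ^ 2 := by
        gcongr with i
        · exact (hy i trivial).1
        · exact (hy i trivial).2
    _ = R ^ 2 / k := by
        simp only [Finset.sum_const, Finset.card_univ, Fintype.card_fin, nsmul_eq_mul]
        field_simp
    _ ≤ R ^ 2 := div_le_self (by positivity) hk'

/-- The restriction of a polynomial `p` to the line through `x` with direction `v`. -/
noncomputable def restrictLine {k : ℕ} (p : MvPolynomial (Fin k) ℝ) (x v : Fin k → ℝ) :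
    Polynomial ℝ :=
  aeval (fun i => Polynomial.C (x i) + Polynomial.C (v i) * Polynomial.X) p

theorem eval_restrictLine {k : ℕ} (p : MvPolynomial (Fin k) ℝ) (x v : Fin k → ℝ) (s : ℝ) :
    (restrictLine p x v).eval s = eval (x + s • v) p := by
  unfold restrictLine
  induction p using MvPolynomial.induction_on with
  | C a => simp
  | add p q hp hq => simp [hp, hq]
  | mul_X p i hp =>
    rw [map_mul, Polynomial.eval_mul, hp, map_mul, aeval_X, eval_X]
    simp [mul_comm s]

theorem natDegree_restrictLine_le {k : ℕ} (p : MvPolynomial (Fin k) ℝ) (x v : Fin k → ℝ) :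
    (restrictLine p x v).natDegree ≤ p.totalDegree := by
  have h := MvPolynomial.aeval_natDegree_le p le_rfl
    (fun i => Polynomial.C (x i) + Polynomial.C (v i) * Polynomial.X) (n := 1)
    (fun i => by compute_degree)
  simpa [restrictLine] using h

/-- A real polynomial vanishing at `0` has square at most `s / 2` for small `s > 0`. -/
theorem eventually_sq_eval_le_half {f : Polynomial ℝ} (hf : f.eval 0 = 0) :
    ∀ᶠ s in nhdsWithin (0 : ℝ) (Set.Ioi 0), f.eval s ^ 2 ≤ s / 2 := by
  obtain ⟨g, rfl⟩ : Polynomial.X ∣ f := by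
    rwa [Polynomial.X_dvd_iff, Polynomial.coeff_zero_eq_eval_zero]
  have hc : Continuous fun s : ℝ => s * g.eval s ^ 2 := by fun_prop
  have hlt : ∀ᶠ s in nhds (0 : ℝ), s * g.eval s ^ 2 < 1 / 2 :=
    hc.continuousAt.eventually_lt continuousAt_const (by norm_num)
  filter_upwards [nhdsWithin_le_nhds hlt, self_mem_nhdsWithin] with s hs (hs0 : 0 < s)
  rw [Polynomial.eval_mul, Polynomial.eval_X]
  nlinarith

/-- The square of a nonzero real polynomial of degree at most `D` dominates `s ^ (2 * D + 1)`
for small `s > 0`. -/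
theorem eventually_pow_le_half_sq_eval {q : Polynomial ℝ} (hq : q ≠ 0) {D : ℕ}
    (hD : q.natDegree ≤ D) :
    ∀ᶠ s in nhdsWithin (0 : ℝ) (Set.Ioi 0), s ^ (2 * D + 1) ≤ q.eval s ^ 2 / 2 := by
  obtain ⟨r, hqr, hr⟩ := Polynomial.exists_eq_pow_rootMultiplicity_mul_and_not_dvd q hq 0
  have hd : q.rootMultiplicity 0 ≤ D := by
    have h := Polynomial.natDegree_le_of_dvd (Polynomial.pow_rootMultiplicity_dvd q 0) hq
    rw [Polynomial.natDegree_pow, Polynomial.natDegree_X_sub_C, mul_one] at h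
    exact h.trans hD
  generalize q.rootMultiplicity 0 = d at hqr hd
  rw [Polynomial.dvd_iff_isRoot, Polynomial.IsRoot.def] at hr
  have hc : Continuous fun s : ℝ => r.eval s ^ 2 / 2 := by fun_prop
  have hlt : ∀ᶠ s in nhds (0 : ℝ), s < r.eval s ^ 2 / 2 :=
    continuousAt_id.eventually_lt hc.continuousAt (by simp only [id]; positivity)
  filter_upwards [nhdsWithin_le_nhds hlt, self_mem_nhdsWithin,
    nhdsWithin_le_nhds (eventually_lt_nhds (zero_lt_one' ℝ))] with s hs (hs0 : 0 < s) hs1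
  calc s ^ (2 * D + 1) ≤ s ^ (2 * d + 1) := pow_le_pow_of_le_one hs0.le hs1.le (by omega)
    _ = (s ^ d) ^ 2 * s := by ring
    _ ≤ (s ^ d) ^ 2 * (r.eval s ^ 2 / 2) := by gcongr
    _ = q.eval s ^ 2 / 2 := by
        rw [hqr]
        simp only [map_zero, sub_zero, Polynomial.eval_mul, Polynomial.eval_pow, Polynomial.eval_X]
        ring

/-- the Hausdorff limit as `t → 0⁺` of the family
`T_t = {x : P(x)² ≤ t(Q(x)² − t^N), |x|² ≤ R²}` (with `F·Q = P`, `Q ≠ 0`,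
`N = 2 deg Q + 1`) is the zero set of `F` in the closed ball of radius `R`. -/
theorem stmt4 (k : ℕ) (hk : 1 ≤ k) (F P Q : MvPolynomial (Fin k) ℝ)
    (hFQ : F * Q = P) (hQ : Q ≠ 0) (R : ℝ) (hR : 0 < R)
    (N : ℕ) (hN : N = 2 * Q.totalDegree + 1)
    (T : Set ((Fin k → ℝ) × ℝ))
    (hT : T = {p | 0 < p.2 ∧
      (MvPolynomial.eval p.1 P) ^ 2 ≤ p.2 * ((MvPolynomial.eval p.1 Q) ^ 2 - p.2 ^ N) ∧
      (∑ i, (p.1 i) ^ 2) ≤ R ^ 2}) :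
    {x : Fin k → ℝ | (x, (0 : ℝ)) ∈ closure T} =
      {x : Fin k → ℝ | MvPolynomial.eval x F = 0 ∧ (∑ i, (x i) ^ 2) ≤ R ^ 2} := by
  subst hFQ hN hT
  ext x
  simp only [Set.mem_ofPred_eq]
  constructor
  · intro hx
    have hF : Continuous fun p : (Fin k → ℝ) × ℝ => eval p.1 F :=
      (MvPolynomial.continuous_eval F).comp continuous_fst
    have hsum : Continuous fun p : (Fin k → ℝ) × ℝ => ∑ i, p.1 i ^ 2 := by fun_prop
    have hcl : IsClosed {p : (Fin k → ℝ) × ℝ |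
        eval p.1 F ^ 2 ≤ p.2 ∧ ∑ i, p.1 i ^ 2 ≤ R ^ 2} :=
      (isClosed_le (hF.pow 2) continuous_snd).inter
        (isClosed_le hsum continuous_const)
    have hmem := closure_minimal ?_ hcl hx
    · obtain ⟨h1, h2⟩ := hmem
      exact ⟨by simpa using le_antisymm h1 (sq_nonneg _), h2⟩
    · rintro ⟨y, t⟩ ⟨ht, hle, hy⟩
      refine ⟨?_, hy⟩
      simp only [map_mul, mul_pow] at ht hle ⊢
      have htN : 0 < t ^ (2 * Q.totalDegree + 1) := by positivity
      have hQ2 : 0 < eval y Q ^ 2 := by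
        by_contra! h
        have := mul_nonneg (sq_nonneg (eval y F)) (sq_nonneg (eval y Q))
        nlinarith
      refine le_of_mul_le_mul_right ?_ hQ2
      nlinarith
  · rintro ⟨hFx, hxR⟩
    obtain ⟨y, hy, hyR⟩ := exists_eval_ne_zero_sum_sq_le hk hQ hR
    have hf : (restrictLine F x (y - x)).eval 0 = 0 := by simpa [eval_restrictLine] using hFx
    have hq : restrictLine Q x (y - x) ≠ 0 := by
      intro h
      apply hy
      simpa [eval_restrictLine] using congrArg (Polynomial.eval 1) h
    have hlim : Filter.Tendsto (fun s : ℝ => (x + s • (y - x), s))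
        (nhdsWithin 0 (Set.Ioi 0)) (nhds (x, 0)) := by
      have hc : Continuous fun s : ℝ => (x + s • (y - x), s) := by fun_prop
      simpa using (hc.tendsto 0).mono_left nhdsWithin_le_nhds
    refine mem_closure_of_tendsto hlim ?_
    filter_upwards [eventually_sq_eval_le_half hf,
      eventually_pow_le_half_sq_eval hq (natDegree_restrictLine_le Q x (y - x)),
      self_mem_nhdsWithin,
      nhdsWithin_le_nhds (eventually_lt_nhds (zero_lt_one' ℝ))] with s h1 h2 (hs0 : 0 < s) hs1
    rw [eval_restrictLine] at h1 h2
    refine ⟨hs0, ?_, ?_⟩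
    · simp only [map_mul, mul_pow]
      nlinarith [mul_le_mul_of_nonneg_right h1 (sq_nonneg (eval (x + s • (y - x)) Q))]
    · calc ∑ i, (x + s • (y - x)) i ^ 2 ≤ ∑ i, ((1 - s) * x i ^ 2 + s * y i ^ 2) := by
            refine Finset.sum_le_sum fun i _ => ?_
            simp only [Pi.add_apply, Pi.smul_apply, Pi.sub_apply, smul_eq_mul]
            nlinarith [mul_nonneg (mul_nonneg hs0.le (sub_nonneg.2 hs1.le))
              (sq_nonneg (x i - y i))]
        _ = (1 - s) * ∑ i, x i ^ 2 + s * ∑ i, y i ^ 2 := by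
            rw [Finset.sum_add_distrib, Finset.mul_sum, Finset.mul_sum]
        _ ≤ R ^ 2 := by nlinarith
end

section
/- Let n ≥ 1 and k₁,…,k_n ≥ 1 with k = k₁ + … + k_n, and write points of ℝ^k as x = (x¹,…,xⁿ) with x^b ∈ ℝ^{k_b}. Let F₁,…,F_s, P₁,…,P_s, Q₁,…,Q_s ∈ ℝ[X₁,…,X_k] satisfy F_i·Q_i = P_i and Q_i ≠ 0 for every i. Set P̄_i = P_i·∏_{j≠i} Q_j, Q̄ = ∏_{j=1}^s Q_j, and N = 2·deg(Q̄) + 1. Let A be a finite index set and S : A → (subsets of {1,…,s}), and let W = ⋃_{α∈A} ⋂_{i∈S(α)} {x ∈ ℝ^k : F_i(x) = 0} (every quantifier-free formula in the F_i containing no negations and no inequalities has a realization of this disjunctive-normal form). For each r = (r₁,…,r_n) with all r_b > 0, let B̄_r = {x ∈ ℝ^k : |x^b|² ≤ r_b² for all b = 1,…,n} and T_r = {(x,u) ∈ ℝ^k × ℝ : u > 0, x ∈ B̄_r, and there exists α ∈ A such that P̄_i(x)² ≤ u·(Q̄(x)² − u^N) for all i ∈ S(α)}. Then (T_r)_limit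 = W ∩ B̄_r. -/
open MvPolynomial

open Polynomial in
/-- The restriction of a polynomial of total degree at most `d` to a line is a univariate polynomial
of degree at most `d`. -/
lemma exists_polynomial_eval_line {σ : Type*} (p : MvPolynomial σ ℝ) (x v : σ → ℝ) :
    ∃ q : ℝ[X], q.natDegree ≤ p.totalDegree ∧
      ∀ t : ℝ, q.eval t = MvPolynomial.eval (fun i => x i + t * v i) p := by
  refine ⟨MvPolynomial.aeval (fun i => Polynomial.C (x i) + Polynomial.X * Polynomial.C (v i)) p,
    ?_, fun t => ?_⟩
  · have h := MvPolynomial.aeval_natDegree_le p le_rfl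
      (fun i => (Polynomial.C (x i) + Polynomial.X * Polynomial.C (v i) : ℝ[X])) (n := 1)
      (fun i => by compute_degree)
    simpa using h
  · rw [← Polynomial.coe_evalRingHom, MvPolynomial.map_aeval, MvPolynomial.eval,
      MvPolynomial.coe_eval₂Hom, MvPolynomial.coe_eval₂Hom]
    congr 1
    · ext; simp
    · ext i; simp [mul_comm (v i)]

open Polynomial Filter Topology in
/-- If `f 0 = 0`, `q ≠ 0` and `N > 2 * deg q`, then `f² q² ≤ t (q² - t ^ N)` for small `t > 0`. -/
lemma eventually_sq_mul_sq_le (f q : ℝ[X]) (hf : f.eval 0 = 0) (hq : q ≠ 0) (d : ℕ)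
    (hd : q.natDegree ≤ d) :
    ∀ᶠ t : ℝ in 𝓝[>] 0,
      (f.eval t * q.eval t) ^ 2 ≤ t * (q.eval t ^ 2 - t ^ (2 * d + 1)) := by
  obtain ⟨h, rfl⟩ : Polynomial.X ∣ f := by
    rwa [Polynomial.X_dvd_iff, Polynomial.coeff_zero_eq_eval_zero]
  obtain ⟨g, hg, hndvd⟩ := q.exists_eq_pow_rootMultiplicity_mul_and_not_dvd hq 0
  have hmd : q.rootMultiplicity 0 ≤ d := by
    classical
    refine le_trans ?_ hd
    rw [← Polynomial.count_roots]
    exact (Multiset.count_le_card _ _).trans q.card_roots'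
  generalize q.rootMultiplicity 0 = m at hg hmd
  obtain ⟨e, rfl⟩ := Nat.exists_eq_add_of_le hmd
  have hg0 : g.eval 0 ≠ 0 := by
    rwa [Polynomial.dvd_iff_isRoot] at hndvd
  have hcont : Continuous fun t : ℝ =>
      g.eval t ^ 2 - (t * (h.eval t * g.eval t) ^ 2 + t ^ (2 * e + 1)) := by fun_prop
  have hpos : ∀ᶠ t : ℝ in 𝓝 0,
      0 < g.eval t ^ 2 - (t * (h.eval t * g.eval t) ^ 2 + t ^ (2 * e + 1)) := by
    refine hcont.continuousAt.eventually (lt_mem_nhds ?_)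
    simp only [zero_mul, ne_eq, Nat.add_eq_zero_iff, one_ne_zero, and_false, not_false_eq_true,
      zero_pow, add_zero, sub_zero]
    positivity
  filter_upwards [hpos.filter_mono nhdsWithin_le_nhds, self_mem_nhdsWithin] with t ht ht0
  have ht0 : 0 < t := ht0
  have key : 0 ≤ t * t ^ (2 * m) *
      (g.eval t ^ 2 - (t * (h.eval t * g.eval t) ^ 2 + t ^ (2 * e + 1))) := by positivity
  rw [hg]
  simp only [map_zero, sub_zero, Polynomial.eval_mul, Polynomial.eval_pow, Polynomial.eval_X]
  refine sub_nonneg.mp (key.trans_eq ?_)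
  ring

/-- The product of closed Euclidean balls is convex. -/
lemma convex_blockBall {n : ℕ} {kv : Fin n → ℕ} (r : Fin n → ℝ) :
    Convex ℝ {x : ((b : Fin n) × Fin (kv b)) → ℝ |
      ∀ b : Fin n, (∑ i : Fin (kv b), (x ⟨b, i⟩) ^ 2) ≤ (r b) ^ 2} := by
  intro x hx z hz a c ha hc hac b
  calc ∑ i : Fin (kv b), ((a • x + c • z) ⟨b, i⟩) ^ 2
      ≤ ∑ i : Fin (kv b), (a * x ⟨b, i⟩ ^ 2 + c * z ⟨b, i⟩ ^ 2) := by
        refine Finset.sum_le_sum fun i _ => ?_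
        simpa using (even_two.convexOn_pow (𝕜 := ℝ)).2
          (Set.mem_univ (x ⟨b, i⟩)) (Set.mem_univ (z ⟨b, i⟩)) ha hc hac
    _ = a * ∑ i : Fin (kv b), x ⟨b, i⟩ ^ 2 + c * ∑ i : Fin (kv b), z ⟨b, i⟩ ^ 2 := by
        rw [Finset.sum_add_distrib, Finset.mul_sum, Finset.mul_sum]
    _ ≤ a * r b ^ 2 + c * r b ^ 2 := by
        gcongr
        · exact hx b
        · exact hz b
    _ = r b ^ 2 := by rw [← add_mul, hac, one_mul]

/-- A nonzero polynomial does not vanish identically on a product of closed balls. -/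
lemma exists_eval_ne_zero_mem_blockBall {n : ℕ} {kv : Fin n → ℕ} {r : Fin n → ℝ}
    (hr : ∀ b, 0 < r b) {p : MvPolynomial ((b : Fin n) × Fin (kv b)) ℝ} (hp : p ≠ 0) :
    ∃ z : ((b : Fin n) × Fin (kv b)) → ℝ,
      (∀ b : Fin n, (∑ i : Fin (kv b), (z ⟨b, i⟩) ^ 2) ≤ (r b) ^ 2) ∧
      MvPolynomial.eval z p ≠ 0 := by
  by_contra! hall
  refine hp (MvPolynomial.funext_set
    (fun j : (b : Fin n) × Fin (kv b) => Set.Icc (0 : ℝ) (r j.1 / kv j.1)) (fun j => ?_)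
    fun z hz => ?_)
  · have : 0 < kv j.1 := j.2.pos
    exact Set.Icc_infinite (div_pos (hr _) (by exact_mod_cast this))
  · rw [map_zero]
    refine hall z fun b => ?_
    rcases Nat.eq_zero_or_pos (kv b) with hb | hb
    · have : IsEmpty (Fin (kv b)) := by rw [hb]; infer_instance
      simpa using sq_nonneg (r b)
    have hb1 : (1 : ℝ) ≤ kv b := by exact_mod_cast hb
    calc ∑ i : Fin (kv b), z ⟨b, i⟩ ^ 2 ≤ ∑ _i : Fin (kv b), (r b / kv b) ^ 2 := by
          refine Finset.sum_le_sum fun i _ => ?_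
          have := hz ⟨b, i⟩ (Set.mem_univ _)
          exact pow_le_pow_left₀ this.1 this.2 2
      _ = r b ^ 2 / kv b := by
          simp only [Finset.sum_const, Finset.card_univ, Fintype.card_fin, nsmul_eq_mul]
          field_simp
      _ ≤ r b ^ 2 := div_le_self (sq_nonneg _) hb1

/-- block version.  For `F_i·Q_i = P_i` with `Q_i ≠ 0`, with
`P̄_i = P_i·∏_{j≠i} Q_j`, `Q̄ = ∏_j Q_j`, `N = 2 deg Q̄ + 1`, and
`W = ⋃_α ⋂_{i ∈ S α} {F_i = 0}`, the Hausdorff limit as `u → 0⁺` of the family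
`T_u = {x ∈ B̄_r : ∃ α, ∀ i ∈ S α, P̄_i(x)² ≤ u(Q̄(x)² − u^N)}` equals
`W ∩ B̄_r`, where `B̄_r` is the product of the closed balls of radii `r_b` in
the coordinate blocks. -/
theorem stmt5 (n : ℕ) (hn : 1 ≤ n) (kv : Fin n → ℕ) (hkv : ∀ b, 1 ≤ kv b)
    (s : ℕ) (F P Q : Fin s → MvPolynomial ((b : Fin n) × Fin (kv b)) ℝ)
    (hFQ : ∀ i, F i * Q i = P i) (hQ : ∀ i, Q i ≠ 0)
    (Pbar : Fin s → MvPolynomial ((b : Fin n) × Fin (kv b)) ℝ)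
    (hPbar : ∀ i, Pbar i = P i * ∏ j ∈ Finset.univ.erase i, Q j)
    (Qbar : MvPolynomial ((b : Fin n) × Fin (kv b)) ℝ) (hQbar : Qbar = ∏ j, Q j)
    (N : ℕ) (hN : N = 2 * Qbar.totalDegree + 1)
    (A : Type) [Fintype A] (S : A → Set (Fin s))
    (W : Set (((b : Fin n) × Fin (kv b)) → ℝ))
    (hW : W = ⋃ a : A, ⋂ i ∈ S a, {x | MvPolynomial.eval x (F i) = 0})
    (r : Fin n → ℝ) (hr : ∀ b, 0 < r b)
    (Br : Set (((b : Fin n) × Fin (kv b)) → ℝ))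
    (hBr : Br = {x | ∀ b : Fin n, (∑ i : Fin (kv b), (x ⟨b, i⟩) ^ 2) ≤ (r b) ^ 2})
    (T : Set ((((b : Fin n) × Fin (kv b)) → ℝ) × ℝ))
    (hT : T = {p | 0 < p.2 ∧ p.1 ∈ Br ∧ ∃ a : A, ∀ i ∈ S a,
      (MvPolynomial.eval p.1 (Pbar i)) ^ 2 ≤
        p.2 * ((MvPolynomial.eval p.1 Qbar) ^ 2 - p.2 ^ N)}) :
    {x | (x, (0 : ℝ)) ∈ closure T} = W ∩ Br := by
  have hPF : ∀ i, Pbar i = F i * Qbar := fun i => by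
    rw [hPbar, ← hFQ, mul_assoc, Finset.mul_prod_erase _ _ (Finset.mem_univ i), hQbar]
  have hQbar0 : Qbar ≠ 0 := hQbar ▸ Finset.prod_ne_zero_iff.mpr fun i _ => hQ i
  simp only [hPF, map_mul] at hT
  ext x
  simp only [Set.mem_ofPred_eq]
  constructor
  · intro hx
    let C : Set ((((b : Fin n) × Fin (kv b)) → ℝ) × ℝ) :=
      {p | p.1 ∈ Br} ∩ ⋃ a : A, ⋂ i ∈ S a, {p | MvPolynomial.eval p.1 (F i) ^ 2 ≤ p.2}
    have hC : IsClosed C := by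
      refine IsClosed.inter ?_ (isClosed_iUnion_of_finite fun a =>
        isClosed_biInter fun i _ => ?_)
      · refine IsClosed.preimage (t := Br) continuous_fst ?_
        rw [hBr, Set.ofPred_forall]
        exact isClosed_iInter fun b => isClosed_le (by fun_prop) continuous_const
      · exact isClosed_le (((F i).continuous_eval.comp continuous_fst).pow 2) continuous_snd
    have hTC : T ⊆ C := by
      rw [hT]
      rintro ⟨y, u⟩ ⟨hu, hy, a, ha⟩
      refine ⟨hy, Set.mem_iUnion.mpr ⟨a, Set.mem_iInter₂.mpr fun i hi => ?_⟩⟩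
      have h := ha i hi
      simp only [Set.mem_ofPred_eq] at hu h ⊢
      have huN : 0 < u ^ N := pow_pos hu N
      have hsq : 0 < MvPolynomial.eval y Qbar ^ 2 := by
        have h0 := nonneg_of_mul_nonneg_right ((sq_nonneg _).trans h) hu
        linarith
      refine le_of_mul_le_mul_right ?_ hsq
      rw [← mul_pow]
      refine h.trans (mul_le_mul_of_nonneg_left ?_ hu.le)
      linarith
    obtain ⟨hxB, hxF⟩ := closure_minimal hTC hC hx
    refine ⟨?_, hxB⟩
    rw [hW]
    simpa using hxF
  · rintro ⟨hxW, hxB⟩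
    rw [hW] at hxW
    simp only [Set.mem_iUnion, Set.mem_iInter, Set.mem_ofPred_eq] at hxW
    obtain ⟨a, ha⟩ := hxW
    obtain ⟨z, hzB, hz⟩ := exists_eval_ne_zero_mem_blockBall hr hQbar0
    choose f _ hf using fun i => exists_polynomial_eval_line (F i) x (z - x)
    obtain ⟨q, hqd, hq⟩ := exists_polynomial_eval_line Qbar x (z - x)
    have hq0 : q ≠ 0 := by
      rintro rfl
      apply hz
      simpa using (hq 1).symm
    have hev : ∀ᶠ t : ℝ in nhdsWithin 0 (Set.Ioi 0), ∀ i, i ∈ S a →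
        ((f i).eval t * q.eval t) ^ 2 ≤ t * (q.eval t ^ 2 - t ^ N) := by
      rw [Filter.eventually_all]
      intro i
      by_cases hi : i ∈ S a
      · have h0 : (f i).eval 0 = 0 := by rw [hf]; simpa using ha i hi
        filter_upwards [eventually_sq_mul_sq_le (f i) q h0 hq0 _ hqd] with t ht _
        rwa [hN]
      · exact Filter.Eventually.of_forall fun t h => absurd h hi
    have hlim : Filter.Tendsto (fun t : ℝ => ((fun i => x i + t * (z - x) i), t)) (nhdsWithin 0 (Set.Ioi 0))
        (nhds (x, 0)) := by
      have hcont : Continuous fun t : ℝ => ((fun i => x i + t * (z - x) i), t) := by fun_prop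
      have h := hcont.tendsto 0
      simp only [zero_mul, add_zero] at h
      exact h.mono_left nhdsWithin_le_nhds
    refine mem_closure_of_tendsto hlim ?_
    filter_upwards [hev, self_mem_nhdsWithin,
      Filter.Eventually.filter_mono nhdsWithin_le_nhds (gt_mem_nhds (zero_lt_one' ℝ))]
      with t ht ht0 ht1
    rw [hT]
    refine ⟨ht0, ?_, a, fun i hi => ?_⟩
    · have hseg := (convex_blockBall (kv := kv) r).add_smul_sub_mem (hBr ▸ hxB) hzB
        ⟨le_of_lt ht0, ht1.le⟩
      rw [hBr]
      exact hseg
    · have h := ht i hi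
      rwa [hf, hq] at h
end

section
/- Let k, a, s ∈ ℕ and let F₁,…,F_s ∈ ℝ[X₁,…,X_k] have total additive complexity at most a (i.e. there exist a₁,…,a_s with the additive complexity of F_i at most a_i and ∑ a_i ≤ a). Let n ≥ 1 and k₁,…,k_n ≥ 1 with k = k₁+…+k_n be a block decomposition of the variables, let A be a finite index set, S : A → (subsets of {1,…,s}), and W = ⋃_{α∈A} ⋂_{i∈S(α)} {x ∈ ℝ^k : F_i(x) = 0}. Then there exist finitely many polynomials P′₁,…,P′_{s′} ∈ ℝ[X₁,…,X_k,U] whose division-free additive complexities sum to at most (k+a)(a+2), and a set T′ ⊆ ℝ^{k+1} that is a Boolean combination of the sign sets of P′₁,…,P′_{s′}, such that for every r = (r₁,…,r_n) with all r_b > 0, writing B̄_r = {x ∈ ℝ^k : |x^b|² ≤ r_b² for all blocks b}, one has ({(x,u) ∈ T′ : u > 0 and x ∈ B̄_r})_limit = W ∩ B̄_r. -/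
open MvPolynomial

/-- `P` has division-free additive complexity at most `a`: there is a
straight-line sequence `Q₁,…,Q_a` of polynomials, each a sum of two terms built
from monomials (with natural-number exponents) and earlier `Q_i`'s, such that
`P` is a constant times a monomial times a product of powers of the `Q_j`'s. -/
def DivFreeAddCompLE {σ : Type} [Fintype σ] (a : ℕ) (P : MvPolynomial σ ℝ) : Prop :=
  ∃ (Q : Fin a → MvPolynomial σ ℝ) (u v : Fin a → ℝ)
    (α β : Fin a → σ → ℕ) (γ δ : Fin a → Fin a → ℕ)
    (c : ℝ) (ζ : σ → ℕ) (η : Fin a → ℕ),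
    (∀ j : Fin a,
      Q j = MvPolynomial.C (u j) * (∏ i, MvPolynomial.X i ^ α j i) *
              (∏ i ∈ Finset.univ.filter (· < j), Q i ^ γ j i)
          + MvPolynomial.C (v j) * (∏ i, MvPolynomial.X i ^ β j i) *
              (∏ i ∈ Finset.univ.filter (· < j), Q i ^ δ j i)) ∧
    P = MvPolynomial.C c * (∏ i, MvPolynomial.X i ^ ζ i) * ∏ j, Q j ^ η j

/-- `P` has additive complexity at most `a`: same as division-free additive
complexity, but the intermediate quantities `Q₁,…,Q_a` live in the fraction
field and all exponents are integers (negative powers in the fraction field). -/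
def AddCompLE {σ : Type} [Fintype σ] (a : ℕ) (P : MvPolynomial σ ℝ) : Prop :=
  ∃ (Q : Fin a → FractionRing (MvPolynomial σ ℝ)) (u v : Fin a → ℝ)
    (α β : Fin a → σ → ℤ) (γ δ : Fin a → Fin a → ℤ)
    (c : ℝ) (ζ : σ → ℤ) (η : Fin a → ℤ),
    (∀ j : Fin a,
      Q j = algebraMap (MvPolynomial σ ℝ) (FractionRing (MvPolynomial σ ℝ))
              (MvPolynomial.C (u j)) *
            (∏ i, (algebraMap (MvPolynomial σ ℝ) (FractionRing (MvPolynomial σ ℝ))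
              (MvPolynomial.X i)) ^ α j i) *
            (∏ i ∈ Finset.univ.filter (· < j), Q i ^ γ j i)
          + algebraMap (MvPolynomial σ ℝ) (FractionRing (MvPolynomial σ ℝ))
              (MvPolynomial.C (v j)) *
            (∏ i, (algebraMap (MvPolynomial σ ℝ) (FractionRing (MvPolynomial σ ℝ))
              (MvPolynomial.X i)) ^ β j i) *
            (∏ i ∈ Finset.univ.filter (· < j), Q i ^ δ j i)) ∧
    algebraMap (MvPolynomial σ ℝ) (FractionRing (MvPolynomial σ ℝ)) P =
      algebraMap (MvPolynomial σ ℝ) (FractionRing (MvPolynomial σ ℝ))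
        (MvPolynomial.C c) *
      (∏ i, (algebraMap (MvPolynomial σ ℝ) (FractionRing (MvPolynomial σ ℝ))
        (MvPolynomial.X i)) ^ ζ i) *
      ∏ j, Q j ^ η j

section Laurent

variable {K : Type*} [Field K] {ι : Type*} [Fintype ι]

/-- Constant multiples of Laurent monomials in a family `g` of nonzero elements of a field. -/
def laurentMonomials (φ : ℝ →+* K) (g : ι → K) (hg : ∀ i, g i ≠ 0) : Submonoid K where
  carrier := {x | ∃ (c : ℝ) (n : ι → ℤ), x = φ c * ∏ i, g i ^ n i}
  one_mem' := ⟨1, 0, by simp⟩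
  mul_mem' := by
    rintro _ _ ⟨c, n, rfl⟩ ⟨d, m, rfl⟩
    refine ⟨c * d, n + m, ?_⟩
    simp only [map_mul, Pi.add_apply, zpow_add₀ (hg _), Finset.prod_mul_distrib]
    ring

variable {φ : ℝ →+* K} {g : ι → K} {hg : ∀ i, g i ≠ 0}

lemma zpow_mem_laurentMonomials {x : K} (hx : x ∈ laurentMonomials φ g hg) (m : ℤ) :
    x ^ m ∈ laurentMonomials φ g hg := by
  obtain ⟨c, n, rfl⟩ := hx
  refine ⟨c ^ m, fun i => n i * m, ?_⟩
  simp only [mul_zpow, map_zpow₀, zpow_mul, Finset.prod_zpow]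

lemma const_mem_laurentMonomials (c : ℝ) : φ c ∈ laurentMonomials φ g hg :=
  ⟨c, 0, by simp⟩

lemma gen_mem_laurentMonomials (i : ι) : g i ∈ laurentMonomials φ g hg := by
  classical
  refine ⟨1, Pi.single i 1, ?_⟩
  rw [Finset.prod_eq_single i] <;> simp +contextual

/-- Two Laurent monomials have a common Laurent monomial factor with ordinary monomials as
cofactors. -/
lemma exists_common_factor {x y : K} (hx : x ∈ laurentMonomials φ g hg)
    (hy : y ∈ laurentMonomials φ g hg) :
    ∃ (c d : ℝ) (n : ι → ℤ) (p q : ι → ℕ),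
      x = (∏ i, g i ^ n i) * (φ c * ∏ i, g i ^ p i) ∧
      y = (∏ i, g i ^ n i) * (φ d * ∏ i, g i ^ q i) := by
  obtain ⟨c, n, rfl⟩ := hx
  obtain ⟨d, m, rfl⟩ := hy
  refine ⟨c, d, fun i => min (n i) (m i), fun i => (n i - min (n i) (m i)).toNat,
    fun i => (m i - min (n i) (m i)).toNat, ?_, ?_⟩ <;>
  · rw [mul_left_comm, ← Finset.prod_mul_distrib]
    congr 1
    refine Finset.prod_congr rfl fun i _ => ?_
    rw [← zpow_natCast, ← zpow_add₀ (hg i)]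
    congr 1
    dsimp only
    omega

lemma exists_clear_denominator {x : K} (hx : x ∈ laurentMonomials φ g hg) :
    ∃ (c : ℝ) (p q : ι → ℕ), x * ∏ i, g i ^ q i = φ c * ∏ i, g i ^ p i := by
  obtain ⟨c, n, rfl⟩ := hx
  refine ⟨c, fun i => (n i).toNat, fun i => (-n i).toNat, ?_⟩
  rw [mul_assoc, ← Finset.prod_mul_distrib]
  congr 1
  refine Finset.prod_congr rfl fun i _ => ?_
  rw [← zpow_natCast, ← zpow_natCast, ← zpow_add₀ (hg i)]
  congr 1
  dsimp only
  omega

end Laurent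

section Chain

lemma prod_filter_lt_castSucc {M : Type*} [CommMonoid M] {a : ℕ} (f : Fin (a + 1) → M)
    (j : Fin a) : ∏ i ∈ Finset.univ.filter (· < j.castSucc), f i =
      ∏ i ∈ Finset.univ.filter (· < j), f i.castSucc := by
  have h : ¬ Fin.last a < j.castSucc := not_lt.2 (Fin.le_last _)
  simp [Finset.prod_filter, Fin.prod_univ_castSucc, h]

lemma prod_filter_lt_last {M : Type*} [CommMonoid M] {a : ℕ} (f : Fin (a + 1) → M) :
    ∏ i ∈ Finset.univ.filter (· < Fin.last a), f i = ∏ i : Fin a, f i.castSucc := by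
  simp only [Finset.prod_filter, Fin.prod_univ_castSucc, Fin.castSucc_lt_last, if_true,
    lt_irrefl, if_false, mul_one]

variable {σ : Type} [Fintype σ]

/-- A division-free straight-line sequence. -/
def IsDivFreeChain {a : ℕ} (Q : Fin a → MvPolynomial σ ℝ) : Prop :=
  ∀ j, ∃ (u v : ℝ) (α β : σ → ℕ) (γ δ : Fin a → ℕ),
    Q j = C u * (∏ i, X i ^ α i) * (∏ i ∈ Finset.univ.filter (· < j), Q i ^ γ i) +
      C v * (∏ i, X i ^ β i) * (∏ i ∈ Finset.univ.filter (· < j), Q i ^ δ i)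

lemma IsDivFreeChain.divFreeAddCompLE {a : ℕ} {Q : Fin a → MvPolynomial σ ℝ}
    (hQ : IsDivFreeChain Q) (j : Fin a) : DivFreeAddCompLE a (Q j) := by
  classical
  choose u v α β γ δ h using hQ
  refine ⟨Q, u, v, α, β, γ, δ, 1, 0, Pi.single j 1, h, ?_⟩
  rw [Finset.prod_eq_single j] <;> simp +contextual

lemma IsDivFreeChain.snoc {a : ℕ} {Q : Fin a → MvPolynomial σ ℝ} (hQ : IsDivFreeChain Q)
    {p : MvPolynomial σ ℝ} {u v : ℝ} {α β : σ → ℕ} {γ δ : Fin a → ℕ}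
    (hp : p = C u * (∏ i, X i ^ α i) * (∏ i, Q i ^ γ i) +
      C v * (∏ i, X i ^ β i) * (∏ i, Q i ^ δ i)) :
    IsDivFreeChain (Fin.snoc Q p : Fin (a + 1) → MvPolynomial σ ℝ) := by
  intro j
  refine Fin.lastCases ?_ (fun j => ?_) j
  · refine ⟨u, v, α, β, Fin.snoc γ 0, Fin.snoc δ 0, ?_⟩
    simpa only [prod_filter_lt_last, Fin.snoc_last, Fin.snoc_castSucc] using hp
  · obtain ⟨u, v, α, β, γ, δ, h⟩ := hQ j
    refine ⟨u, v, α, β, Fin.snoc γ 0, Fin.snoc δ 0, ?_⟩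
    simpa only [prod_filter_lt_castSucc, Fin.snoc_castSucc] using h

lemma prod_X_pow_snoc {k : ℕ} (α : Fin k → ℕ) (m : ℕ) :
    ∏ i, (X i : MvPolynomial (Fin (k + 1)) ℝ) ^ (Fin.snoc α m : Fin (k + 1) → ℕ) i =
      rename Fin.castSucc (∏ i, X i ^ α i) * X (Fin.last k) ^ m := by
  simp [Fin.prod_univ_castSucc]

lemma IsDivFreeChain.rename_castSucc {k a : ℕ} {Q : Fin a → MvPolynomial (Fin k) ℝ}
    (hQ : IsDivFreeChain Q) : IsDivFreeChain fun j => rename Fin.castSucc (Q j) := by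
  intro j
  obtain ⟨u, v, α, β, γ, δ, h⟩ := hQ j
  refine ⟨u, v, Fin.snoc α 0, Fin.snoc β 0, γ, δ, ?_⟩
  simp only [prod_X_pow_snoc, pow_zero, mul_one]
  rw [h]
  simp only [map_add, map_mul, map_prod, map_pow, rename_C]

end Chain

section Generators

variable {σ : Type}

/-- The variables of a polynomial ring together with the members of a sequence, as elements of
the fraction field. -/
noncomputable def chainGenerators {a : ℕ} (Q : Fin a → MvPolynomial σ ℝ) :
    σ ⊕ Fin a → FractionRing (MvPolynomial σ ℝ) :=
  fun i => algebraMap _ _ (Sum.elim X Q i)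

lemma chainGenerators_ne_zero {a : ℕ} {Q : Fin a → MvPolynomial σ ℝ} (hQ : ∀ j, Q j ≠ 0)
    (i : σ ⊕ Fin a) : chainGenerators Q i ≠ 0 := by
  have : Sum.elim X Q i ≠ 0 := by cases i <;> simp [X_ne_zero, hQ]
  simpa [chainGenerators] using this

/-- The constants of the fraction field of a real polynomial ring. -/
noncomputable def fractionConst : ℝ →+* FractionRing (MvPolynomial σ ℝ) :=
  (algebraMap (MvPolynomial σ ℝ) _).comp C

variable [Fintype σ]

lemma fractionConst_mul_prod_chainGenerators {a : ℕ} (Q : Fin a → MvPolynomial σ ℝ) (c : ℝ)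
    (p : σ ⊕ Fin a → ℕ) :
    fractionConst c * ∏ i, chainGenerators Q i ^ p i =
      algebraMap _ _ (C c * (∏ i, X i ^ p (.inl i)) * ∏ j, Q j ^ p (.inr j)) := by
  simp [fractionConst, chainGenerators, Fintype.prod_sum_type, mul_assoc]

lemma laurentMonomials_le_snoc {a : ℕ} {Q : Fin a → MvPolynomial σ ℝ} (hQ : ∀ j, Q j ≠ 0)
    (p : MvPolynomial σ ℝ)
    (hp : ∀ j, (Fin.snoc Q p : Fin (a + 1) → MvPolynomial σ ℝ) j ≠ 0) :
    laurentMonomials fractionConst (chainGenerators Q) (chainGenerators_ne_zero hQ) ≤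
      laurentMonomials fractionConst (chainGenerators (Fin.snoc Q p : Fin (a + 1) → _))
        (chainGenerators_ne_zero hp) := by
  rintro _ ⟨c, n, rfl⟩
  refine ⟨c, Sum.elim (fun i => n (.inl i)) (Fin.snoc (fun j => n (.inr j)) 0), ?_⟩
  simp [chainGenerators, Fintype.prod_sum_type, Fin.prod_univ_castSucc]

lemma term_mem_laurentMonomials {a b : ℕ} {A : Fin b → MvPolynomial σ ℝ} (hA : ∀ j, A j ≠ 0)
    {Q : Fin a → FractionRing (MvPolynomial σ ℝ)} {s : Finset (Fin a)}
    (hQ : ∀ j ∈ s, Q j ∈ laurentMonomials fractionConst (chainGenerators A)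
      (chainGenerators_ne_zero hA)) (c : ℝ) (α : σ → ℤ) (γ : Fin a → ℤ) :
    algebraMap (MvPolynomial σ ℝ) (FractionRing (MvPolynomial σ ℝ)) (C c) *
      (∏ i, (algebraMap (MvPolynomial σ ℝ) (FractionRing (MvPolynomial σ ℝ)) (X i)) ^ α i) *
      (∏ i ∈ s, Q i ^ γ i) ∈
      laurentMonomials fractionConst (chainGenerators A) (chainGenerators_ne_zero hA) := by
  refine mul_mem (mul_mem (const_mem_laurentMonomials c) (prod_mem fun i _ => ?_))
    (prod_mem fun i hi => zpow_mem_laurentMonomials (hQ i hi) _)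
  exact zpow_mem_laurentMonomials (gen_mem_laurentMonomials (Sum.inl i : σ ⊕ Fin b)) _

lemma exists_divFreeChain {a : ℕ} (Q : Fin a → FractionRing (MvPolynomial σ ℝ))
    (hQ : ∀ j, ∃ (u v : ℝ) (α β : σ → ℤ) (γ δ : Fin a → ℤ),
      Q j = algebraMap (MvPolynomial σ ℝ) (FractionRing (MvPolynomial σ ℝ)) (C u) *
          (∏ i, (algebraMap (MvPolynomial σ ℝ) (FractionRing (MvPolynomial σ ℝ)) (X i)) ^ α i) *
          (∏ i ∈ Finset.univ.filter (· < j), Q i ^ γ i) +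
        algebraMap (MvPolynomial σ ℝ) (FractionRing (MvPolynomial σ ℝ)) (C v) *
          (∏ i, (algebraMap (MvPolynomial σ ℝ) (FractionRing (MvPolynomial σ ℝ)) (X i)) ^ β i) *
          (∏ i ∈ Finset.univ.filter (· < j), Q i ^ δ i)) :
    ∃ (A : Fin a → MvPolynomial σ ℝ) (hA : ∀ j, A j ≠ 0), IsDivFreeChain A ∧
      ∀ j, Q j ∈ laurentMonomials fractionConst (chainGenerators A)
        (chainGenerators_ne_zero hA) := by
  induction a with
  | zero => exact ⟨Fin.elim0, fun j => j.elim0, fun j => j.elim0, fun j => j.elim0⟩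
  | succ a ih =>
    obtain ⟨A, hA, hchain, hmem⟩ := ih (fun j => Q j.castSucc) fun j => by
      obtain ⟨u, v, α, β, γ, δ, h⟩ := hQ j.castSucc
      refine ⟨u, v, α, β, fun i => γ i.castSucc, fun i => δ i.castSucc, ?_⟩
      simpa only [prod_filter_lt_castSucc] using h
    obtain ⟨u, v, α, β, γ, δ, h⟩ := hQ (Fin.last a)
    simp only [prod_filter_lt_last] at h
    obtain ⟨c, d, n, p, q, h₁, h₂⟩ := exists_common_factor
      (term_mem_laurentMonomials hA (s := Finset.univ) (fun j _ => hmem j) u α fun i => γ i.castSucc)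
      (term_mem_laurentMonomials hA (s := Finset.univ) (fun j _ => hmem j) v β fun i => δ i.castSucc)
    rw [h₁, h₂, ← mul_add, fractionConst_mul_prod_chainGenerators,
      fractionConst_mul_prod_chainGenerators, ← map_add] at h
    have extend : ∀ t : MvPolynomial σ ℝ, t ≠ 0 →
        ∀ j, (Fin.snoc A t : Fin (a + 1) → MvPolynomial σ ℝ) j ≠ 0 := fun t ht j =>
      Fin.lastCases (by simpa using ht) (fun j => by simpa using hA j) j
    by_cases hb : C c * (∏ i, X i ^ p (.inl i)) * (∏ j, A j ^ p (.inr j)) +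
        C d * (∏ i, X i ^ q (.inl i)) * (∏ j, A j ^ q (.inr j)) = 0
    · refine ⟨Fin.snoc A 1, extend 1 one_ne_zero, hchain.snoc (u := 1) (v := 0) (α := 0)
        (β := 0) (γ := 0) (δ := 0) (by simp), fun j => Fin.lastCases ?_ (fun j => ?_) j⟩
      · rw [h, hb, map_zero, mul_zero, ← map_zero fractionConst]
        exact const_mem_laurentMonomials 0
      · exact laurentMonomials_le_snoc hA _ (extend 1 one_ne_zero) (hmem j)
    · refine ⟨Fin.snoc A _, extend _ hb, hchain.snoc rfl,
        fun j => Fin.lastCases ?_ (fun j => ?_) j⟩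
      · rw [h]
        refine mul_mem (laurentMonomials_le_snoc hA _ (extend _ hb) ⟨1, n, by simp⟩) ?_
        convert gen_mem_laurentMonomials (Sum.inr (Fin.last a)) using 1
        simp [chainGenerators]
      · exact laurentMonomials_le_snoc hA _ (extend _ hb) (hmem j)

/-- A polynomial of additive complexity at most `a` is a quotient of two power products in the
variables and a division-free straight-line sequence of length `a`. -/
lemma AddCompLE.exists_quotient {a : ℕ} {P : MvPolynomial σ ℝ} (hP : AddCompLE a P) :
    ∃ (A : Fin a → MvPolynomial σ ℝ) (c : ℝ) (ζ ζ' : σ → ℕ) (η η' : Fin a → ℕ),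
      IsDivFreeChain A ∧ (∀ j, A j ≠ 0) ∧
      P * ((∏ i, X i ^ ζ' i) * ∏ j, A j ^ η' j) =
        C c * (∏ i, X i ^ ζ i) * ∏ j, A j ^ η j := by
  obtain ⟨Q, u, v, α, β, γ, δ, c, ζ, η, hQ, h⟩ := hP
  obtain ⟨A, hA, hchain, hmem⟩ := exists_divFreeChain Q fun j =>
    ⟨u j, v j, α j, β j, γ j, δ j, hQ j⟩
  have := term_mem_laurentMonomials hA (s := Finset.univ) (fun j _ => hmem j) c ζ η
  rw [← h] at this
  obtain ⟨c, p, q, hpq⟩ := exists_clear_denominator this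
  refine ⟨A, c, fun i => p (.inl i), fun i => q (.inl i), fun j => p (.inr j),
    fun j => q (.inr j), hchain, hA, ?_⟩
  apply IsFractionRing.injective (MvPolynomial σ ℝ) (FractionRing (MvPolynomial σ ℝ))
  rw [← fractionConst_mul_prod_chainGenerators, ← hpq, map_mul]
  congr 1
  simpa using (fractionConst_mul_prod_chainGenerators A 1 q).symm

lemma AddCompLE.exists_pencil {k a : ℕ} {F : MvPolynomial (Fin k) ℝ} (hF : AddCompLE a F) :
    ∃ (D : MvPolynomial (Fin k) ℝ) (R : MvPolynomial (Fin (k + 1)) ℝ), D ≠ 0 ∧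
      DivFreeAddCompLE (a + 1) R ∧ ∀ (x : Fin k → ℝ) (u : ℝ),
        eval (Fin.snoc x u : Fin (k + 1) → ℝ) R = (eval x F ^ 2 - u) * eval x D ^ 2 := by
  obtain ⟨A, c, ζ, ζ', η, η', hchain, hA, h⟩ := hF.exists_quotient
  have hlast := (hchain.rename_castSucc.snoc (u := c ^ 2) (v := -1)
    (α := Fin.snoc (fun i => ζ i * 2) 0) (β := Fin.snoc (fun i => ζ' i * 2) 1)
    (γ := fun j => η j * 2) (δ := fun j => η' j * 2) rfl).divFreeAddCompLE (Fin.last a)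
  rw [Fin.snoc_last] at hlast
  refine ⟨(∏ i, X i ^ ζ' i) * ∏ j, A j ^ η' j, _, ?_, hlast, fun x u => ?_⟩
  · exact mul_ne_zero (Finset.prod_ne_zero_iff.2 fun i _ => pow_ne_zero _ (X_ne_zero i))
      (Finset.prod_ne_zero_iff.2 fun j _ => pow_ne_zero _ (hA j))
  · have hx := congrArg (eval x) h
    have hcomp : (Fin.snoc x u : Fin (k + 1) → ℝ) ∘ Fin.castSucc = x := by
      ext i; simp
    simp only [map_mul, map_prod, map_pow, eval_X, eval_C] at hx
    simp only [prod_X_pow_snoc, map_add, map_mul, map_prod, map_pow, eval_X, eval_C, eval_rename,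
      hcomp, Fin.snoc_last, Fin.snoc_castSucc, pow_mul, Finset.prod_pow, rename_X, pow_one,
      pow_zero, map_one]
    linear_combination -(congrArg (· ^ 2) hx)

end Generators

section SignConditions

lemma dense_eval_ne_zero {k : ℕ} {G : MvPolynomial (Fin k) ℝ} (hG : G ≠ 0) :
    Dense {x : Fin k → ℝ | eval x G ≠ 0} := by
  refine Metric.dense_iff.2 fun x ε hε => ?_
  by_contra hempty
  refine hG (funext_set (fun i => Metric.ball (x i) ε) (fun i => ?_) fun y hy => ?_)
  · rw [Real.ball_eq_Ioo]
    exact Set.Ioo_infinite (by linarith)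
  · rw [← ball_pi x hε] at hy
    by_contra hne
    exact hempty ⟨y, hy, by simpa using hne⟩

lemma mem_closure_inter_of_dense {k n : ℕ} {kv : Fin n → ℕ}
    (e : (b : Fin n) → Fin (kv b) → Fin k) {r : Fin n → ℝ} (hr : ∀ b, 0 < r b)
    {D : Set (Fin k → ℝ)} (hD : Dense D) {x : Fin k → ℝ}
    (hx : ∀ b, ∑ i, x (e b i) ^ 2 ≤ r b ^ 2) :
    x ∈ closure ({y | ∀ b, ∑ i, y (e b i) ^ 2 ≤ r b ^ 2} ∩ D) := by
  have hopen : IsOpen {y : Fin k → ℝ | ∀ b, ∑ i, y (e b i) ^ 2 < r b ^ 2} := by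
    simp only [Set.ofPred_forall]
    exact isOpen_iInter_of_finite fun b => isOpen_lt (by fun_prop) continuous_const
  have hmaps : Set.MapsTo (fun t : ℝ => t • x) (Set.Ico 0 1)
      {y : Fin k → ℝ | ∀ b, ∑ i, y (e b i) ^ 2 < r b ^ 2} := by
    rintro t ⟨ht₀, ht₁⟩ b
    simp only [Pi.smul_apply, smul_eq_mul, mul_pow, ← Finset.mul_sum]
    have h₁ : t ^ 2 < 1 := by nlinarith
    have h₂ : 0 < r b ^ 2 := pow_pos (hr b) 2
    nlinarith [hx b, mul_le_mul_of_nonneg_left (hx b) (sq_nonneg t)]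
  have hx' := map_mem_closure (f := fun t : ℝ => t • x) (x := 1) (by fun_prop)
    (by rw [closure_Ico zero_ne_one]; simp) hmaps
  rw [one_smul] at hx'
  have := closure_mono (hD.open_subset_closure_inter hopen) hx'
  rw [closure_closure] at this
  exact closure_mono (Set.inter_subset_inter_left _ fun y hy b => (hy b).le) this

lemma AddCompLE.exists_X_dvd {k : ℕ} {F : MvPolynomial (Fin k) ℝ} (hF : AddCompLE 0 F)
    (hF₀ : F ≠ 0) {x : Fin k → ℝ} (hx : eval x F = 0) : ∃ j, X j ∣ F ∧ x j = 0 := by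
  obtain ⟨A, c, ζ, ζ', η, η', -, -, h⟩ := hF.exists_quotient
  simp only [Finset.univ_eq_empty, Finset.prod_empty, mul_one] at h
  have hne : F * ∏ i, X i ^ ζ' i ≠ 0 :=
    mul_ne_zero hF₀ (Finset.prod_ne_zero_iff.2 fun i _ => pow_ne_zero _ (X_ne_zero i))
  have hc : c ≠ 0 := by
    rintro rfl
    exact hne (by rw [h, C_0, zero_mul])
  have hdvd : F ∣ monomial (Finsupp.equivFunOnFinite.symm ζ) 1 * C c := by
    refine ⟨_, (Eq.trans ?_ h.symm)⟩
    rw [monomial_eq, Finsupp.prod_fintype _ _ (by simp)]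
    simp [mul_comm]
  obtain ⟨m, R, -, hR, rfl⟩ := dvd_monomial_mul_iff_exists.1 hdvd
  have hRx : eval x R ≠ 0 := by
    have := map_dvd (eval x) hR
    rw [eval_C] at this
    exact ne_zero_of_dvd_ne_zero hc this
  rw [map_mul, eval_monomial, one_mul, mul_eq_zero, or_iff_left hRx,
    Finsupp.prod, Finset.prod_eq_zero_iff] at hx
  obtain ⟨j, hj, hxj⟩ := hx
  exact ⟨j, (X_dvd_monomial.2 (.inr (Finsupp.mem_support_iff.1 hj))).mul_right R,
    eq_zero_of_pow_eq_zero hxj⟩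

lemma isClosed_setOf_exists_sq_le {k : ℕ} (J : Set (Fin k)) :
    IsClosed {p : (Fin k → ℝ) × ℝ | ∃ j ∈ J, p.1 j ^ 2 ≤ p.2} := by
  have : {p : (Fin k → ℝ) × ℝ | ∃ j ∈ J, p.1 j ^ 2 ≤ p.2} =
      ⋃ j ∈ J, {p | p.1 j ^ 2 ≤ p.2} := by ext; simp
  rw [this]
  exact J.toFinite.isClosed_biUnion fun j _ => isClosed_le (by fun_prop) (by fun_prop)

/-- The zero set of a polynomial of additive complexity at most `a` is the limit at `u = 0` of
a sign condition on a single polynomial of division-free additive complexity at most `2 * a`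
and the polynomials `X j ^ 2 - u`. -/
lemma AddCompLE.exists_sign_condition {k a : ℕ} {F : MvPolynomial (Fin k) ℝ}
    (hF : AddCompLE a F) :
    ∃ (R : MvPolynomial (Fin (k + 1)) ℝ) (D : MvPolynomial (Fin k) ℝ) (m : ℕ)
      (V : Set ((Fin k → SignType) × SignType)),
      m ≤ 2 * a ∧ DivFreeAddCompLE m R ∧ D ≠ 0 ∧
      (∀ x : Fin k → ℝ, (x, (0 : ℝ)) ∈ closure {p : (Fin k → ℝ) × ℝ | 0 < p.2 ∧
        (fun j => SignType.sign (p.1 j ^ 2 - p.2),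
          SignType.sign (eval (Fin.snoc p.1 p.2 : Fin (k + 1) → ℝ) R)) ∈ V} → eval x F = 0) ∧
      ∀ x : Fin k → ℝ, eval x F = 0 → ∀ u : ℝ, 0 < u → ∀ᶠ y in nhds x, eval y D ≠ 0 →
        (fun j => SignType.sign (y j ^ 2 - u),
          SignType.sign (eval (Fin.snoc y u : Fin (k + 1) → ℝ) R)) ∈ V := by
  have hzero : DivFreeAddCompLE 0 (0 : MvPolynomial (Fin (k + 1)) ℝ) :=
    ⟨Fin.elim0, Fin.elim0, Fin.elim0, Fin.elim0, Fin.elim0, Fin.elim0, Fin.elim0, 0, 0,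
      Fin.elim0, fun j => j.elim0, by simp⟩
  by_cases hF₀ : F = 0
  · exact ⟨0, 1, 0, Set.univ, by simp, hzero, one_ne_zero, by simp [hF₀], by simp⟩
  rcases Nat.eq_zero_or_pos a with rfl | ha
  · refine ⟨0, 1, 0, {q | ∃ j ∈ {j | X j ∣ F}, q.1 j = -1}, by simp, hzero, one_ne_zero,
      fun x hx => ?_, fun x hx u hu => ?_⟩
    · have hx' := closure_minimal (fun p hp => ?_) (isClosed_setOf_exists_sq_le {j | X j ∣ F}) hx
      · obtain ⟨j, ⟨E, rfl⟩, hj⟩ := hx'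
        have hxj : x j = 0 := pow_eq_zero_iff two_ne_zero |>.1 (le_antisymm hj (sq_nonneg _))
        simp [hxj]
      · obtain ⟨-, j, hj, hsign⟩ := hp
        exact ⟨j, hj, by linarith [sign_eq_neg_one_iff.1 hsign]⟩
    · obtain ⟨j, hj, hxj⟩ := hF.exists_X_dvd hF₀ hx
      have hlt : ∀ᶠ y : Fin k → ℝ in nhds x, y j ^ 2 < u :=
        (by fun_prop : Continuous fun y : Fin k → ℝ => y j ^ 2).continuousAt.eventually_lt
          continuousAt_const (by simpa [hxj] using hu)
      filter_upwards [hlt] with y hy _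
      exact ⟨j, hj, sign_eq_neg_one_iff.2 (by simpa using hy)⟩
  · obtain ⟨D, R, hD, hR, heval⟩ := hF.exists_pencil
    have hcont : Continuous fun y : Fin k → ℝ => eval y F ^ 2 := (continuous_eval F).pow 2
    refine ⟨R, D, a + 1, {q | q.2 = -1}, by omega, hR, hD, fun x hx => ?_, fun x hx u hu => ?_⟩
    · have hclosed : IsClosed {p : (Fin k → ℝ) × ℝ | eval p.1 F ^ 2 ≤ p.2} :=
        isClosed_le (hcont.comp continuous_fst) continuous_snd
      have hx' := closure_minimal (fun p hp => ?_) hclosed hx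
      · exact pow_eq_zero_iff two_ne_zero |>.1 (le_antisymm hx' (sq_nonneg _))
      · have hneg := sign_eq_neg_one_iff.1 hp.2
        rw [heval] at hneg
        exact (sub_neg.1 (neg_of_mul_neg_left hneg (sq_nonneg _))).le
    · have hlt : ∀ᶠ y : Fin k → ℝ in nhds x, eval y F ^ 2 < u :=
        hcont.continuousAt.eventually_lt continuousAt_const (by simpa [hx] using hu)
      filter_upwards [hlt] with y hy hDy
      refine sign_eq_neg_one_iff.2 ?_
      rw [heval]
      exact mul_neg_of_neg_of_pos (sub_neg.2 hy) (by positivity)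

lemma divFreeAddCompLE_X_sq_sub_X {k : ℕ} (i j : Fin k) :
    DivFreeAddCompLE 1 (X i ^ 2 - X j : MvPolynomial (Fin k) ℝ) := by
  have hnil : IsDivFreeChain (Fin.elim0 : Fin 0 → MvPolynomial (Fin k) ℝ) := fun j => j.elim0
  have := (hnil.snoc (p := X i ^ 2 - X j) (u := 1) (v := -1) (α := Pi.single i 2)
    (β := Pi.single j 1) (γ := Fin.elim0) (δ := Fin.elim0) ?_).divFreeAddCompLE (Fin.last 0)
  · rwa [Fin.snoc_last] at this
  · have hprod : ∀ (l : Fin k) (m : ℕ),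
        ∏ i, (X i : MvPolynomial (Fin k) ℝ) ^ (Pi.single l m : Fin k → ℕ) i = X l ^ m := by
      intro l m
      rw [Finset.prod_eq_single l] <;> simp +contextual
    simp [hprod, sub_eq_add_neg]

end SignConditions

/-- a set `W` defined, without negations and inequalities, from
polynomials `F₁,…,F_s` of total additive complexity at most `a`, is, inside
every product of closed balls `B̄_r`, the Hausdorff limit of a one-parameter
family which is a Boolean combination of sign sets of polynomials in one more
variable whose division-free additive complexities sum to at most
`(k+a)(a+2)`. -/
theorem stmt6 (k a s : ℕ) (F : Fin s → MvPolynomial (Fin k) ℝ)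
    (hF : ∃ a' : Fin s → ℕ, (∀ i, AddCompLE (a' i) (F i)) ∧ (∑ i, a' i) ≤ a)
    (n : ℕ) (hn : 1 ≤ n) (kv : Fin n → ℕ) (hkv : ∀ b, 1 ≤ kv b)
    (hk : k = ∑ b, kv b)
    (e : ((b : Fin n) × Fin (kv b)) ≃ Fin k)
    (A : Type) [Fintype A] (S : A → Set (Fin s))
    (W : Set (Fin k → ℝ))
    (hW : W = ⋃ al : A, ⋂ i ∈ S al, {x | MvPolynomial.eval x (F i) = 0}) :
    ∃ (s' : ℕ) (P' : Fin s' → MvPolynomial (Fin (k + 1)) ℝ) (a' : Fin s' → ℕ),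
      (∀ i, DivFreeAddCompLE (a' i) (P' i)) ∧ (∑ i, a' i) ≤ (k + a) * (a + 2) ∧
      ∃ T' : Set ((Fin k → ℝ) × ℝ),
        (∃ Sg : Set (Fin s' → SignType),
          T' = ⋃ τ ∈ Sg, {p : (Fin k → ℝ) × ℝ | ∀ i,
            SignType.sign (MvPolynomial.eval (Fin.snoc p.1 p.2) (P' i)) = τ i}) ∧
        ∀ r : Fin n → ℝ, (∀ b, 0 < r b) →
          {x : Fin k → ℝ | (x, (0 : ℝ)) ∈ closure
              {p ∈ T' | 0 < p.2 ∧
                ∀ b : Fin n, (∑ i : Fin (kv b), (p.1 (e ⟨b, i⟩)) ^ 2) ≤ (r b) ^ 2}} =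
            W ∩ {x | ∀ b : Fin n, (∑ i : Fin (kv b), (x (e ⟨b, i⟩)) ^ 2) ≤ (r b) ^ 2} := by
  obtain ⟨a', ha', hsum⟩ := hF
  choose R D m V hm hR hD hlim happ using fun i => (ha' i).exists_sign_condition
  refine ⟨k + s, Fin.append (fun j => X j.castSucc ^ 2 - X (Fin.last k)) R,
    Fin.append (fun _ => 1) m, fun i => ?_, ?_, ?_⟩
  · refine Fin.addCases (fun j => ?_) (fun j => ?_) i
    · simpa using divFreeAddCompLE_X_sq_sub_X j.castSucc (Fin.last k)
    · simpa using hR j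
  · have hms : ∑ i, m i ≤ 2 * a := by
      calc ∑ i, m i ≤ ∑ i, 2 * a' i := Finset.sum_le_sum fun i _ => hm i
        _ = 2 * ∑ i, a' i := by rw [Finset.mul_sum]
        _ ≤ 2 * a := by omega
    simp only [Fin.sum_univ_add, Fin.append_left, Fin.append_right, Finset.sum_const,
      Finset.card_univ, Fintype.card_fin, smul_eq_mul, mul_one]
    nlinarith [Nat.zero_le (k * a), Nat.zero_le (a * a)]
  let signs (i : Fin s) (p : (Fin k → ℝ) × ℝ) : (Fin k → SignType) × SignType :=
    (fun j => SignType.sign (p.1 j ^ 2 - p.2),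
      SignType.sign (eval (Fin.snoc p.1 p.2 : Fin (k + 1) → ℝ) (R i)))
  refine ⟨{p | ∃ al : A, ∀ i ∈ S al, signs i p ∈ V i},
    ⟨{τ | ∃ al : A, ∀ i ∈ S al, (fun j => τ (Fin.castAdd s j), τ (Fin.natAdd k i)) ∈ V i}, ?_⟩,
    fun r hr => ?_⟩
  · ext p
    have hτ : ∀ τ : Fin (k + s) → SignType, (∀ i, SignType.sign (eval (Fin.snoc p.1 p.2)
        (Fin.append (fun j => X j.castSucc ^ 2 - X (Fin.last k)) R i)) = τ i) ↔
        (fun i => SignType.sign (eval (Fin.snoc p.1 p.2)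
        (Fin.append (fun j => X j.castSucc ^ 2 - X (Fin.last k)) R i))) = τ :=
      fun τ => funext_iff.symm
    simp only [Set.mem_iUnion, Set.mem_ofPred_eq, hτ, exists_prop, exists_eq_right', signs,
      Fin.append_left, Fin.append_right, map_sub, map_pow, eval_X, Fin.snoc_castSucc,
      Fin.snoc_last]
  · subst hW
    ext x
    simp only [Set.mem_ofPred_eq, Set.mem_inter_iff, Set.mem_iUnion, Set.mem_iInter]
    constructor
    · intro hx
      refine ⟨?_, ?_⟩
      · have hsub : {p : (Fin k → ℝ) × ℝ | (∃ al : A, ∀ i ∈ S al, signs i p ∈ V i) ∧ 0 < p.2 ∧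
            ∀ b : Fin n, (∑ i : Fin (kv b), (p.1 (e ⟨b, i⟩)) ^ 2) ≤ (r b) ^ 2} ⊆
            ⋃ al : A, {p | 0 < p.2 ∧ ∀ i ∈ S al, signs i p ∈ V i} := by
          rintro p ⟨⟨al, hal⟩, hp, -⟩
          exact Set.mem_iUnion.2 ⟨al, hp, hal⟩
        have hx' := closure_mono hsub hx
        rw [closure_iUnion_of_finite] at hx'
        obtain ⟨al, hal⟩ := Set.mem_iUnion.1 hx'
        refine ⟨al, fun i hi => hlim i x (closure_mono ?_ hal)⟩
        exact fun p hp => ⟨hp.1, hp.2 i hi⟩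
      · have hclosed : IsClosed {p : (Fin k → ℝ) × ℝ |
            ∀ b : Fin n, (∑ i : Fin (kv b), (p.1 (e ⟨b, i⟩)) ^ 2) ≤ (r b) ^ 2} := by
          simp only [Set.ofPred_forall]
          exact isClosed_iInter fun b => isClosed_le (by fun_prop) continuous_const
        exact closure_minimal (fun p hp => hp.2.2) hclosed hx
    · rintro ⟨⟨al, hal⟩, hx⟩
      have hdense := dense_eval_ne_zero (Finset.prod_ne_zero_iff.2 fun i _ => hD i :
        ∏ i, D i ≠ 0)
      have hcl := mem_closure_inter_of_dense (fun b i => e ⟨b, i⟩) hr hdense hx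
      refine mem_closure_iff_nhds.2 fun N hN => ?_
      rw [nhds_prod_eq] at hN
      obtain ⟨N₁, hN₁, N₂, hN₂, hN⟩ := Filter.mem_prod_iff.1 hN
      obtain ⟨u, huN, hu⟩ : ∃ u ∈ N₂, 0 < u :=
        Filter.nonempty_of_mem (f := nhdsWithin (0 : ℝ) (Set.Ioi 0))
          (Filter.inter_mem (mem_nhdsWithin_of_mem_nhds hN₂) self_mem_nhdsWithin)
      have hev : ∀ᶠ y in nhds x, ∀ i ∈ S al, eval y (D i) ≠ 0 → signs i (y, u) ∈ V i := by
        refine Filter.eventually_all.2 fun i => ?_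
        by_cases hi : i ∈ S al
        · filter_upwards [happ i x (hal i hi) u hu] with y hy _ using hy
        · exact Filter.Eventually.of_forall fun y h => absurd h hi
      obtain ⟨y, ⟨hyN, hy⟩, hyB, hyD⟩ :=
        mem_closure_iff_nhds.1 hcl _ (Filter.inter_mem hN₁ hev)
      rw [Set.mem_ofPred_eq, map_prod, Finset.prod_ne_zero_iff] at hyD
      exact ⟨(y, u), hN ⟨hyN, huN⟩, ⟨al, fun i hi => hy i hi (hyD i (Finset.mem_univ i))⟩,
        hu, hyB⟩
end

section
/- Let R > 0 and let T ⊆ ℝ^k × ℝ be a set with T ⊆ ℝ^k × (0,∞). Suppose that for every t > 0 the fiber T_t = {x ∈ ℝ^k : (x,t) ∈ T} is a closed subset of ℝ^k contained in the open ball B(0,R), and that the family is monotone: T_t ⊆ T_{t'} whenever 0 < t ≤ t'. Then ⋂_{t>0} T_t = T_limit, that is, ⋂_{t>0} T_t = {x ∈ ℝ^k : (x,0) ∈ closure(T)}, where the closure is taken in ℝ^{k+1}. -/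
/-- for a monotone one-parameter family `T ⊆ ℝ^k × (0,∞)` with
closed fibers contained in the ball `B(0,R)`, the intersection `⋂_{t>0} T_t`
equals `T_limit = {x : (x,0) ∈ closure T}`. -/
theorem stmt12 (k : ℕ) (R : ℝ) (hR : 0 < R)
    (T : Set (EuclideanSpace ℝ (Fin k) × ℝ))
    (hpos : ∀ p ∈ T, 0 < p.2)
    (hclosed : ∀ t : ℝ, 0 < t → IsClosed {x : EuclideanSpace ℝ (Fin k) | (x, t) ∈ T})
    (hball : ∀ t : ℝ, 0 < t →
      {x : EuclideanSpace ℝ (Fin k) | (x, t) ∈ T} ⊆ Metric.ball 0 R)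
    (hmono : ∀ t t' : ℝ, 0 < t → t ≤ t' →
      {x : EuclideanSpace ℝ (Fin k) | (x, t) ∈ T} ⊆
        {x : EuclideanSpace ℝ (Fin k) | (x, t') ∈ T}) :
    (⋂ t ∈ Set.Ioi (0 : ℝ), {x : EuclideanSpace ℝ (Fin k) | (x, t) ∈ T}) =
      {x : EuclideanSpace ℝ (Fin k) | (x, (0 : ℝ)) ∈ closure T} := by
  ext x
  simp only [Set.mem_iInter, Set.mem_Ioi, Set.mem_ofPred_eq]
  constructor
  · intro h
    have hcont : Continuous fun t : ℝ => (x, t) := by fun_prop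
    refine mem_closure_of_tendsto (b := nhdsWithin (0 : ℝ) (Set.Ioi 0))
      ((hcont.tendsto 0).mono_left nhdsWithin_le_nhds) ?_
    filter_upwards [self_mem_nhdsWithin] with t ht using h t ht
  · intro hx t ht
    refine (hclosed t ht).closure_subset (Metric.mem_closure_iff.2 fun ε hε => ?_)
    obtain ⟨p, hpT, hp⟩ := Metric.mem_closure_iff.1 hx (min ε t) (lt_min hε ht)
    rw [Prod.dist_eq, max_lt_iff, lt_min_iff, lt_min_iff, Real.dist_eq, abs_lt, abs_lt] at hp
    exact ⟨p.1, hmono p.2 t (hpos p hpT) (by linarith [hp.2.2.1]) hpT, hp.1.1⟩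
end
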